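/- arXiv:2206.06538 — 2 statements merged into one kernel-verified Lean document; each statement's English description precedes it below -/
import Mathlib

section
/- Fix n ≥ 1 and suppose that for every smooth Bruhat interval [u,w] in the symmetric group S_{n+1} there exists s ∈ S ∖ D_L(u) such that either su ≰ w or sw < w. Then for every smooth Bruhat interval [u,w] in S_{n+1}, the dual poset [u,w]* is a zircon. -/
namespace Paper

/-! ### Bruhat order on a Coxeter group -/

variable {B W : Type*} [Group W] {M : CoxeterMatrix B}

/-- One step in the Bruhat order: multiply on the left by a reflection,
increasing the length. -/
def BruhatStep (cs : CoxeterSystem M W) (a b : W) : Prop :=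
  ∃ t : W, cs.IsReflection t ∧ b = t * a ∧ cs.length a < cs.length b

/-- The Bruhat order on a Coxeter group. -/
def BruhatLE (cs : CoxeterSystem M W) : W → W → Prop :=
  Relation.ReflTransGen (BruhatStep cs)

theorem BruhatLE.length_le {cs : CoxeterSystem M W} {a b : W} (h : BruhatLE cs a b) :
    cs.length a ≤ cs.length b := by
  induction h with
  | refl => exact le_rfl
  | tail _ h ih => obtain ⟨t, -, -, hlt⟩ := h; exact ih.trans hlt.le

theorem BruhatLE.length_lt {cs : CoxeterSystem M W} {a b : W} (h : BruhatLE cs a b)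
    (hne : a ≠ b) : cs.length a < cs.length b := by
  rcases Relation.ReflTransGen.cases_head h with h' | ⟨c, hc, h'⟩
  · exact absurd h' hne
  · obtain ⟨t, -, -, hlt⟩ := hc
    exact lt_of_lt_of_le hlt (BruhatLE.length_le h')

theorem BruhatLE.antisymm {cs : CoxeterSystem M W} {a b : W} (h1 : BruhatLE cs a b)
    (h2 : BruhatLE cs b a) : a = b := by
  by_contra hne
  exact absurd (BruhatLE.length_lt h1 hne) (not_lt.mpr (BruhatLE.length_le h2))

/-- The Bruhat interval `[u,w]`, as a type. -/
abbrev BruhatInterval (cs : CoxeterSystem M W) (u w : W) : Type _ :=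
  {y : W // BruhatLE cs u y ∧ BruhatLE cs y w}

/-- The Bruhat interval `[u,w]` is a poset under the Bruhat order. -/
instance (cs : CoxeterSystem M W) (u w : W) : PartialOrder (BruhatInterval cs u w) where
  le a b := BruhatLE cs a.1 b.1
  le_refl _ := Relation.ReflTransGen.refl
  le_trans _ _ _ := Relation.ReflTransGen.trans
  le_antisymm _ _ h1 h2 := Subtype.ext (BruhatLE.antisymm h1 h2)

/-- A principal order ideal `{v : v ≤ x}` of the Bruhat order, as a type. -/
abbrev BruhatIdeal (cs : CoxeterSystem M W) (x : W) : Type _ :=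
  {v : W // BruhatLE cs v x}

/-- A principal order ideal of the Bruhat order is a poset under the Bruhat order. -/
instance (cs : CoxeterSystem M W) (x : W) : PartialOrder (BruhatIdeal cs x) where
  le a b := BruhatLE cs a.1 b.1
  le_refl _ := Relation.ReflTransGen.refl
  le_trans _ _ _ := Relation.ReflTransGen.trans
  le_antisymm _ _ h1 h2 := Subtype.ext (BruhatLE.antisymm h1 h2)

/-! ### Posets: matchings, special matchings and zircons -/

/-- A matching of a poset: an involution matching each element with an element
covering it or covered by it. -/
def IsMatching {α : Type*} [PartialOrder α] (f : α → α) : Prop :=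
  Function.Involutive f ∧ ∀ x : α, f x ⋖ x ∨ x ⋖ f x

/-- A special matching of a poset. -/
def IsSpecialMatching {α : Type*} [PartialOrder α] (f : α → α) : Prop :=
  IsMatching f ∧ ∀ x y : α, x ⋖ y → f x = y ∨ f x < f y

/-- A zircon: a poset in which the principal order ideal of every non-minimal element is
finite and has a special matching. -/
def IsZircon (α : Type*) [PartialOrder α] : Prop :=
  ∀ x : α, (∃ y : α, y < x) →
    ({v : α | v ≤ x}.Finite ∧
      ∃ f : {v : α // v ≤ x} → {v : α // v ≤ x}, IsSpecialMatching f)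

/-- The degree of `v` in the Bruhat graph of the interval `[u,w]`: the number of `y ∈ [u,w]`
such that `v⁻¹ * y` is a reflection. -/
noncomputable def bruhatDeg (cs : CoxeterSystem M W) (u w v : W) : ℕ :=
  Nat.card {y : W // (BruhatLE cs u y ∧ BruhatLE cs y w) ∧ cs.IsReflection (v⁻¹ * y)}

/-- A Bruhat interval `[u,w]` is rationally smooth if `deg_{y,w}(y) = ℓ(w) - ℓ(y)` for all
`y ∈ [u,w]` (Carrell–Peterson). -/
def RationallySmooth (cs : CoxeterSystem M W) (u w : W) : Prop :=
  ∀ y : W, BruhatLE cs u y → BruhatLE cs y w →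
    bruhatDeg cs y w y = cs.length w - cs.length y

/-! ### Strong exchange -/

section StrongExchange

open Classical in
/-- The involution of `W × ℤ/2` attached to a simple reflection `s`, sending `(t, ε)` to
`(s t s, ε + 1)` if `t = s`, and to `(s t s, ε)` otherwise. -/
noncomputable def signedConj (cs : CoxeterSystem M W) (i : B) :
    Function.End (W × ZMod 2) :=
  fun p => (cs.simple i * p.1 * cs.simple i, p.2 + if p.1 = cs.simple i then 1 else 0)

open Classical in
theorem signedConj_mul_pow (cs : CoxeterSystem M W) (i j : B) (k : ℕ) (p : W × ZMod 2) :
    ((signedConj cs i * signedConj cs j) ^ k) p =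
      ((cs.simple i * cs.simple j) ^ k * p.1 * ((cs.simple i * cs.simple j) ^ k)⁻¹,
        p.2 + ∑ l ∈ Finset.range (2 * k),
          if p.1 = ((cs.simple i * cs.simple j) ^ l)⁻¹ * cs.simple j then 1 else 0) := by
  set c := cs.simple i * cs.simple j with hc
  have hcinv : c⁻¹ = cs.simple j * cs.simple i := by simp [hc]
  have hjc : ∀ m : ℕ, cs.simple j * c ^ m = (c ^ m)⁻¹ * cs.simple j := by
    intro m
    induction m with
    | zero => simp
    | succ m ih =>
      rw [pow_succ, ← mul_assoc, ih, mul_inv_rev, hcinv, ← inv_pow, hcinv, hc]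
      have := ((Commute.refl (cs.simple j * cs.simple i)).pow_right m).eq
      rw [this]
      simp only [mul_assoc]
  induction k with
  | zero => simp; rfl
  | succ k ih =>
    rw [pow_succ']
    change signedConj cs i (signedConj cs j (((signedConj cs i * signedConj cs j) ^ k) p)) = _
    rw [ih]
    have e1 : c ^ k * p.1 * (c ^ k)⁻¹ = cs.simple j ↔ p.1 = (c ^ (2 * k))⁻¹ * cs.simple j := by
      rw [mul_inv_eq_iff_eq_mul, hjc, ← eq_inv_mul_iff_mul_eq, two_mul, pow_add, mul_inv_rev,
        mul_assoc]
    have e2 : cs.simple j * (c ^ k * p.1 * (c ^ k)⁻¹) * cs.simple j = cs.simple i ↔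
        p.1 = (c ^ (2 * k + 1))⁻¹ * cs.simple j := by
      have h1 : cs.simple j * (c ^ k * p.1 * (c ^ k)⁻¹) * cs.simple j = cs.simple i ↔
          c ^ k * p.1 * (c ^ k)⁻¹ = c⁻¹ * cs.simple j := by
        rw [hcinv]
        constructor
        · intro h; rw [← h]; simp [mul_assoc]
        · intro h; rw [h]; simp [mul_assoc]
      rw [h1, mul_inv_eq_iff_eq_mul, mul_assoc, hjc, ← eq_inv_mul_iff_mul_eq, two_mul, pow_succ',
        pow_add]
      have h3 : ∀ g d y : W, Commute g d → d⁻¹ * (g⁻¹ * (d⁻¹ * y)) = (g * (d * d))⁻¹ * y := by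
        intro g d y h
        rw [mul_inv_rev, mul_inv_rev]
        simp only [mul_assoc]
        rw [h.inv_inv.left_comm]
      rw [h3 _ _ _ ((Commute.refl c).pow_right k)]
    refine Prod.ext ?_ ?_
    · simp only [signedConj, pow_succ', mul_inv_rev, hcinv]
      simp only [hc, mul_assoc]
    · rw [show 2 * (k + 1) = 2 * k + 1 + 1 by ring, Finset.sum_range_succ, Finset.sum_range_succ]
      simp only [signedConj, e1, e2, add_assoc]

theorem signedConj_isLiftable (cs : CoxeterSystem M W) : M.IsLiftable (signedConj cs) := by
  classical
  intro i j
  funext p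
  have h := cs.simple_mul_simple_pow i j
  rw [signedConj_mul_pow, h, two_mul, Finset.sum_range_add]
  simp only [pow_add, h, one_mul, inv_one, mul_one]
  rw [CharTwo.add_self_eq_zero, add_zero]
  rfl

/-- The action of `W` on `W × ℤ/2` by conjugation on the first factor, the second one recording
the parity of the number of times the first is inverted. -/
noncomputable def signedConjHom (cs : CoxeterSystem M W) : W →* Function.End (W × ZMod 2) :=
  cs.lift ⟨signedConj cs, signedConj_isLiftable cs⟩

/-- The characteristic function (with values in `ℤ/2`) of the right inversions of `w`. -/
noncomputable def inversionParity (cs : CoxeterSystem M W) (w t : W) : ZMod 2 :=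
  (signedConjHom cs w (t, 0)).2

theorem signedConjHom_simple (cs : CoxeterSystem M W) (i : B) :
    signedConjHom cs (cs.simple i) = signedConj cs i :=
  cs.lift_apply_simple (signedConj_isLiftable cs) i

theorem signedConjHom_apply (cs : CoxeterSystem M W) (w t : W) (ε : ZMod 2) :
    signedConjHom cs w (t, ε) = (w * t * w⁻¹, ε + inversionParity cs w t) := by
  unfold inversionParity
  induction w using cs.simple_induction_left generalizing t ε with
  | one =>
    simp only [map_one]
    change (t, ε) = (1 * t * 1⁻¹, ε + 0)
    simp
  | mul_simple_left w i ih =>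
    simp only [map_mul, signedConjHom_simple]
    change signedConj cs i (signedConjHom cs w (t, ε)) = (_, _ +
      (signedConj cs i (signedConjHom cs w (t, 0))).2)
    rw [ih t ε, ih t 0]
    simp [signedConj, mul_assoc, add_assoc]

theorem inversionParity_mul (cs : CoxeterSystem M W) (v w t : W) :
    inversionParity cs (v * w) t =
      inversionParity cs w t + inversionParity cs v (w * t * w⁻¹) := by
  have h : signedConjHom cs (v * w) (t, 0) = signedConjHom cs v (signedConjHom cs w (t, 0)) := by
    rw [map_mul]; rfl
  rw [signedConjHom_apply, signedConjHom_apply, signedConjHom_apply] at h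
  simpa using congrArg Prod.snd h

theorem inversionParity_one (cs : CoxeterSystem M W) (t : W) : inversionParity cs 1 t = 0 := by
  simp only [inversionParity, map_one]
  rfl

open Classical in
theorem inversionParity_simple (cs : CoxeterSystem M W) (i : B) (t : W) :
    inversionParity cs (cs.simple i) t = if t = cs.simple i then 1 else 0 := by
  simp only [inversionParity, signedConjHom_simple, signedConj, zero_add]

theorem inversionParity_self (cs : CoxeterSystem M W) {t : W} (ht : cs.IsReflection t) :
    inversionParity cs t t = 1 := by
  obtain ⟨w, i, rfl⟩ := ht
  have h := inversionParity_mul cs w w⁻¹ (w * cs.simple i * w⁻¹)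
  have e : w⁻¹ * (w * cs.simple i * w⁻¹) * w⁻¹⁻¹ = cs.simple i := by group
  rw [mul_inv_cancel, inversionParity_one, e] at h
  rw [inversionParity_mul cs (w * cs.simple i) w⁻¹, e, inversionParity_mul cs w (cs.simple i),
    inversionParity_simple, if_pos rfl, add_left_comm]
  simp [← h]

theorem mem_rightInvSeq_of_inversionParity (cs : CoxeterSystem M W) (ω : List B) {t : W}
    (h : inversionParity cs (cs.wordProd ω) t ≠ 0) : t ∈ cs.rightInvSeq ω := by
  induction ω with
  | nil => exact absurd (inversionParity_one cs t) (by simpa using h)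
  | cons i ω ih =>
    rw [cs.wordProd_cons, inversionParity_mul, inversionParity_simple] at h
    rw [CoxeterSystem.rightInvSeq, List.mem_cons]
    by_cases h1 : cs.wordProd ω * t * (cs.wordProd ω)⁻¹ = cs.simple i
    · left
      rw [← h1]; group
    · right
      exact ih (by simpa [h1] using h)

theorem isRightInversion_of_inversionParity (cs : CoxeterSystem M W) {w t : W}
    (h : inversionParity cs w t ≠ 0) : cs.IsRightInversion w t := by
  obtain ⟨ω, hω, rfl⟩ := cs.exists_isReduced w
  exact cs.isRightInversion_of_mem_rightInvSeq hω (mem_rightInvSeq_of_inversionParity cs ω h)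

theorem isRightInversion_iff_inversionParity (cs : CoxeterSystem M W) {w t : W}
    (ht : cs.IsReflection t) : cs.IsRightInversion w t ↔ inversionParity cs w t ≠ 0 := by
  refine ⟨fun h h0 => ?_, isRightInversion_of_inversionParity cs⟩
  have h1 : inversionParity cs (w * t) t ≠ 0 := by
    rw [inversionParity_mul, inversionParity_self cs ht, mul_inv_cancel_right, h0]
    decide
  have h2 := (isRightInversion_of_inversionParity cs h1).2
  rw [mul_assoc, ht.mul_self, mul_one] at h2
  exact absurd h2 (not_lt.mpr h.2.le)

/-- Left multiplication by a simple reflection `s` permutes, up to conjugation by `s`, the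
left inversions other than `s`. -/
theorem isLeftInversion_simple_mul_iff (cs : CoxeterSystem M W) (i : B) {a t : W}
    (ht : cs.IsReflection t) (hti : t ≠ cs.simple i) :
    cs.IsLeftInversion (cs.simple i * a) (cs.simple i * t * cs.simple i) ↔
      cs.IsLeftInversion a t := by
  have ht' : cs.IsReflection (cs.simple i * t * cs.simple i) := by
    simpa using ht.conj (cs.simple i)
  have hne : cs.simple i * t * cs.simple i ≠ cs.simple i := by
    intro h
    apply hti
    have := congrArg (fun x => cs.simple i * x * cs.simple i) h
    simpa [mul_assoc] using this
  rw [← cs.isRightInversion_inv_iff, ← cs.isRightInversion_inv_iff,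
    isRightInversion_iff_inversionParity cs ht', isRightInversion_iff_inversionParity cs ht,
    mul_inv_rev, cs.inv_simple, inversionParity_mul, inversionParity_simple, if_neg hne]
  simp [mul_assoc]

end StrongExchange

/-! ### The lifting property -/

section Lifting

variable {cs : CoxeterSystem M W}

theorem BruhatStep.simple_mul {a b : W} (h : BruhatStep cs a b) (i : B) :
    cs.simple i * a = b ∨ BruhatStep cs (cs.simple i * a) (cs.simple i * b) := by
  obtain ⟨t, ht, rfl, hlt⟩ := h
  by_cases hti : t = cs.simple i
  · exact Or.inl (by rw [hti])
  right
  have ht' : cs.IsReflection (cs.simple i * t * cs.simple i) := by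
    simpa using ht.conj (cs.simple i)
  have e : cs.simple i * (t * a) = cs.simple i * t * cs.simple i * (cs.simple i * a) := by
    simp [mul_assoc]
  refine ⟨_, ht', e, ?_⟩
  rw [e]
  refine lt_of_le_of_ne (not_lt.mp fun hlt' => ?_) (ht'.length_mul_right_ne _).symm
  exact absurd ((isLeftInversion_simple_mul_iff cs i ht hti).mp ⟨ht', hlt'⟩).2 (not_lt.mpr hlt.le)

theorem BruhatLE.simple_mul_or_left {y x : W} (h : BruhatLE cs y x) (i : B) :
    BruhatLE cs (cs.simple i * y) (cs.simple i * x) ∨ BruhatLE cs (cs.simple i * y) x := by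
  induction h with
  | refl => exact Or.inl .refl
  | tail _ hbc ih =>
    rcases ih with ih | ih
    · rcases hbc.simple_mul i with rfl | hs
      · exact Or.inr ih
      · exact Or.inl (ih.tail hs)
    · exact Or.inr (ih.tail hbc)

theorem BruhatLE.simple_mul_or_right {y x : W} (h : BruhatLE cs y x) (i : B) :
    BruhatLE cs (cs.simple i * y) (cs.simple i * x) ∨ BruhatLE cs y (cs.simple i * x) := by
  induction h using Relation.ReflTransGen.head_induction_on with
  | refl => exact Or.inl .refl
  | head hab _ ih =>
    rcases ih with ih | ih
    · rcases hab.simple_mul i with rfl | hs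
      · exact Or.inr (by simpa using ih)
      · exact Or.inl (ih.head hs)
    · exact Or.inr (ih.head hab)

theorem bruhatLE_simple_mul {y : W} {i : B}
    (h : cs.length y < cs.length (cs.simple i * y)) : BruhatLE cs y (cs.simple i * y) :=
  .single ⟨_, cs.isReflection_simple i, rfl, h⟩

theorem simple_mul_bruhatLE {y : W} {i : B}
    (h : cs.length (cs.simple i * y) < cs.length y) : BruhatLE cs (cs.simple i * y) y :=
  .single ⟨_, cs.isReflection_simple i, by simp, h⟩

theorem BruhatLE.simple_mul_left {y x : W} {i : B} (h : BruhatLE cs y x)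
    (hx : BruhatLE cs (cs.simple i * x) x) : BruhatLE cs (cs.simple i * y) x :=
  (h.simple_mul_or_left i).elim (·.trans hx) id

theorem BruhatLE.simple_mul_right {y x : W} {i : B} (h : BruhatLE cs y x)
    (hy : BruhatLE cs y (cs.simple i * y)) : BruhatLE cs y (cs.simple i * x) :=
  (h.simple_mul_or_right i).elim hy.trans id

theorem bruhatLE_simple_mul_total (cs : CoxeterSystem M W) (y : W) (i : B) :
    BruhatLE cs y (cs.simple i * y) ∨ BruhatLE cs (cs.simple i * y) y := by
  rcases lt_or_gt_of_ne (cs.length_simple_mul_ne y i) with h | h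
  · exact Or.inr (simple_mul_bruhatLE h)
  · exact Or.inl (bruhatLE_simple_mul h)

theorem simple_mul_ne (cs : CoxeterSystem M W) (y : W) (i : B) : cs.simple i * y ≠ y :=
  fun h => cs.length_simple_mul_ne y i (by rw [h])

end Lifting

/-! ### Finiteness in type `A` -/

section Finiteness

/-- If the finite submonoid generated by `S 0, …, S (m - 1)` is extended by `S m`, where
`S 0, …, S m` satisfy the relations of type `A`, then the resulting submonoid is finite. -/
theorem finite_closure_succ {G : Type*} [Monoid G] (S : ℕ → G) (m : ℕ)
    (hsq : ∀ k ≤ m, S k * S k = 1)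
    (hcomm : ∀ k l, k + 1 < l → l ≤ m → S k * S l = S l * S k)
    (hbraid : ∀ k < m, S (k + 1) * S k * S (k + 1) = S k * S (k + 1) * S k)
    (hfin : (Submonoid.closure (S '' {k | k < m}) : Set G).Finite) :
    (Submonoid.closure (S '' {k | k < m + 1}) : Set G).Finite := by
  set H := Submonoid.closure (S '' {k | k < m}) with hH
  have hSH : ∀ k < m, S k ∈ H := fun k hk => Submonoid.subset_closure ⟨k, hk, rfl⟩
  obtain ⟨D, hD0, hDs⟩ : ∃ D : ℕ → G, D 0 = 1 ∧ ∀ j, D (j + 1) = D j * S (m - j) :=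
    ⟨fun j => Nat.rec 1 (fun j d => d * S (m - j)) j, rfl, fun _ => rfl⟩
  have hDcomm : ∀ j l, l + j < m → D j * S l = S l * D j := by
    intro j
    induction j with
    | zero => intro l _; simp [hD0]
    | succ j ih =>
      intro l hl
      rw [hDs, mul_assoc, ← hcomm l (m - j) (by omega) (by omega), ← mul_assoc,
        ih l (by omega), mul_assoc]
  have hDshift : ∀ j l, m + 1 < l + j → l ≤ m → j ≤ m + 1 →
      D j * S l = S (l - 1) * D j := by
    intro j
    induction j with
    | zero => intro l _ _ _; omega
    | succ j ih =>
      intro l hl hlm hj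
      by_cases h : m + 1 < l + j
      · rw [hDs, mul_assoc, hcomm (m - j) l (by omega) hlm, ← mul_assoc,
          ih l h hlm (by omega), mul_assoc]
      · obtain ⟨i, rfl⟩ : ∃ i, j = i + 1 := ⟨j - 1, by omega⟩
        obtain ⟨k, rfl⟩ : ∃ k, l = k + 1 := ⟨l - 1, by omega⟩
        have e1 : m - i = k + 1 := by omega
        have e2 : m - (i + 1) = k := by omega
        rw [hDs, hDs, e1, e2, Nat.add_sub_cancel]
        calc D i * S (k + 1) * S k * S (k + 1)
            = D i * (S (k + 1) * S k * S (k + 1)) := by simp only [mul_assoc]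
          _ = D i * S k * (S (k + 1) * S k) := by
            rw [hbraid k (by omega)]; simp only [mul_assoc]
          _ = S k * (D i * S (k + 1) * S k) := by
            rw [hDcomm i k (by omega)]; simp only [mul_assoc]
  have hstep : ∀ j l, j ≤ m + 1 → l ≤ m → ∃ h ∈ H, ∃ j' ≤ m + 1, D j * S l = h * D j' := by
    intro j l hj hl
    rcases lt_or_ge (l + j) m with h1 | h1
    · exact ⟨S l, hSH l (by omega), j, hj, hDcomm j l h1⟩
    rcases h1.eq_or_lt with h1 | h1
    · exact ⟨1, H.one_mem, j + 1, by omega, by rw [one_mul, hDs, show m - j = l by omega]⟩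
    obtain ⟨i, rfl⟩ : ∃ i, j = i + 1 := ⟨j - 1, by omega⟩
    rcases (show m ≤ l + i by omega).eq_or_lt with h2 | h2
    · refine ⟨1, H.one_mem, i, by omega, ?_⟩
      rw [hDs, show m - i = l by omega, mul_assoc, hsq l hl, mul_one, one_mul]
    · exact ⟨S (l - 1), hSH _ (by omega), i + 1, hj, hDshift _ l (by omega) hl hj⟩
  refine (Set.Finite.image2 (fun h j => h * D j) hfin (Set.finite_Iic (m + 1))).subset ?_
  intro x hx
  induction hx using Submonoid.closure_induction_right with
  | one => exact ⟨1, H.one_mem, 0, by simp, by simp [hD0]⟩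
  | mul_right x _ y hy ih =>
    obtain ⟨h, hh, j, hj, rfl⟩ := ih
    obtain ⟨l, hl, rfl⟩ := hy
    obtain ⟨h', hh', j', hj', e⟩ := hstep j l hj (Nat.lt_succ_iff.mp hl)
    exact ⟨h * h', H.mul_mem hh hh', j', hj', by simp only [mul_assoc, e]⟩

theorem finite_of_coxeterSystem_A {n : ℕ} (cs : CoxeterSystem (CoxeterMatrix.A n) W) :
    Finite W := by
  let S : ℕ → W := fun k => if h : k < n then cs.simple ⟨k, h⟩ else 1
  have hS : ∀ k (h : k < n), S k = cs.simple ⟨k, h⟩ := fun k h => dif_pos h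
  have hsq : ∀ k, S k * S k = 1 := by
    intro k
    by_cases h : k < n <;> simp [S, h]
  have hinv : ∀ k, (S k)⁻¹ = S k := fun k => inv_eq_of_mul_eq_one_left (hsq k)
  have hcomm : ∀ k l, k + 1 < l → l < n → S k * S l = S l * S k := by
    intro k l hkl hl
    have h := cs.simple_mul_simple_pow ⟨k, by omega⟩ ⟨l, hl⟩
    have hM : CoxeterMatrix.A n ⟨k, by omega⟩ ⟨l, hl⟩ = 2 := by
      change (if _ then _ else if _ then _ else _) = _
      rw [if_neg (by simp; omega), if_neg (by simp; omega)]
    rw [hM, ← hS, ← hS, pow_two] at h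
    rw [← inv_eq_of_mul_eq_one_left h, mul_inv_rev, hinv, hinv]
  have hbraid : ∀ k, k + 1 < n → S (k + 1) * S k * S (k + 1) = S k * S (k + 1) * S k := by
    intro k hk
    have h := cs.simple_mul_simple_pow ⟨k + 1, hk⟩ ⟨k, by omega⟩
    have hM : CoxeterMatrix.A n ⟨k + 1, hk⟩ ⟨k, by omega⟩ = 3 := by
      change (if _ then _ else if _ then _ else _) = _
      rw [if_neg (by simp), if_pos (by simp)]
    rw [hM, ← hS, ← hS, pow_three] at h
    have h' : (S (k + 1) * S k * S (k + 1)) * (S k * S (k + 1) * S k) = 1 := by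
      rw [← h]; simp only [mul_assoc]
    rw [eq_inv_of_mul_eq_one_left h']
    simp only [mul_inv_rev, hinv, mul_assoc]
  have key : ∀ m ≤ n, (Submonoid.closure (S '' {k | k < m}) : Set W).Finite := by
    intro m
    induction m with
    | zero => intro _; simp
    | succ m ih =>
      intro hm
      exact finite_closure_succ S m (fun k _ => hsq k) (fun k l h1 h2 => hcomm k l h1 (by omega))
        (fun k hk => hbraid k (by omega)) (ih (by omega))
  have htop : Submonoid.closure (S '' {k | k < n}) = ⊤ := by
    rw [eq_top_iff, ← cs.submonoid_closure_range_simple]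
    refine Submonoid.closure_mono ?_
    rintro _ ⟨i, rfl⟩
    exact ⟨i, i.2, hS i i.2⟩
  have := key n le_rfl
  rw [htop] at this
  exact Set.finite_univ_iff.mp this

end Finiteness

/-! ### Degrees in the Bruhat graph -/

section Degree

variable {cs : CoxeterSystem M W}

theorem bruhatDeg_eq_ncard (cs : CoxeterSystem M W) (u w v : W) :
    bruhatDeg cs u w v =
      {y : W | (BruhatLE cs u y ∧ BruhatLE cs y w) ∧ cs.IsReflection (v⁻¹ * y)}.ncard :=
  rfl

theorem BruhatLE.step_of_isReflection {x y : W} (h : BruhatLE cs x y)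
    (hr : cs.IsReflection (x⁻¹ * y)) : BruhatStep cs x y := by
  have hne : x ≠ y := by
    rintro rfl
    rw [inv_mul_cancel] at hr
    simpa using hr.odd_length
  exact ⟨x * (x⁻¹ * y) * x⁻¹, hr.conj x, by group, h.length_lt hne⟩

theorem simple_mul_inv_mul (cs : CoxeterSystem M W) (x y : W) (i : B) :
    (cs.simple i * x)⁻¹ * (cs.simple i * y) = x⁻¹ * y := by
  group

theorem bruhatDeg_eq_of_descent [Finite W] {x w : W} {i : B} (hxw : BruhatLE cs x w)
    (hx : BruhatLE cs x (cs.simple i * x)) (hw : BruhatLE cs (cs.simple i * w) w) :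
    bruhatDeg cs x w x = bruhatDeg cs (cs.simple i * x) w (cs.simple i * x) + 1 := by
  have hset : {y : W | (BruhatLE cs x y ∧ BruhatLE cs y w) ∧ cs.IsReflection (x⁻¹ * y)} =
      insert (cs.simple i * x) ((cs.simple i * ·) '' {z : W |
        (BruhatLE cs (cs.simple i * x) z ∧ BruhatLE cs z w) ∧
          cs.IsReflection ((cs.simple i * x)⁻¹ * z)}) := by
    ext y
    constructor
    · rintro ⟨⟨hxy, hyw⟩, hr⟩
      rcases (hxy.step_of_isReflection hr).simple_mul i with h | h
      · exact Or.inl h.symm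
      · refine Or.inr ⟨cs.simple i * y, ⟨⟨.single h, hyw.simple_mul_left hw⟩, ?_⟩, by simp⟩
        rwa [simple_mul_inv_mul]
    · rintro (rfl | ⟨z, ⟨⟨hxz, hzw⟩, hr⟩, rfl⟩)
      · refine ⟨⟨hx, hxw.simple_mul_left hw⟩, ?_⟩
        simpa [mul_assoc] using (cs.isReflection_simple i).conj x⁻¹
      · have hr' : cs.IsReflection (x⁻¹ * (cs.simple i * z)) := by
          rw [← simple_mul_inv_mul cs _ _ i]
          simpa using hr
        refine ⟨⟨?_, hzw.simple_mul_left hw⟩, hr'⟩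
        rcases (hxz.step_of_isReflection hr).simple_mul i with h | h
        · have hz : z = x := by simpa using h.symm
          rw [hz] at hxz ⊢
          exact hx
        · rw [cs.simple_mul_simple_cancel_left] at h
          exact .single h
  rw [bruhatDeg_eq_ncard, hset, Set.ncard_insert_of_notMem _ (Set.toFinite _),
    Set.ncard_image_of_injective _ (mul_right_injective _), ← bruhatDeg_eq_ncard]
  rintro ⟨z, ⟨⟨hxz, -⟩, -⟩, hz⟩
  have hz : z = x := by simpa using hz
  rw [hz] at hxz
  exact simple_mul_ne cs x i (hxz.antisymm hx)

end Degree

/-! ### Translating an interval by a simple reflection -/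

section Translate

variable {cs : CoxeterSystem M W} {u w : W} {i : B}

theorem BruhatLE.simple_mul_of_not_le (hu : ¬ BruhatLE cs (cs.simple i * u) w) {x y : W}
    (hux : BruhatLE cs u x) (hxy : BruhatLE cs x y) (hyw : BruhatLE cs y w) :
    BruhatLE cs (cs.simple i * x) (cs.simple i * y) := by
  have h1 : BruhatLE cs (cs.simple i * u) (cs.simple i * x) :=
    (hux.simple_mul_or_left i).resolve_right fun h => hu (h.trans (hxy.trans hyw))
  exact (hxy.simple_mul_or_left i).resolve_right fun h => hu (h1.trans (h.trans hyw))

theorem BruhatLE.of_simple_mul (hu : ¬ BruhatLE cs (cs.simple i * u) w) {x y : W}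
    (hux : BruhatLE cs (cs.simple i * u) (cs.simple i * x)) (hyw : BruhatLE cs y w)
    (hxy : BruhatLE cs (cs.simple i * x) (cs.simple i * y)) : BruhatLE cs x y := by
  rcases hxy.simple_mul_or_right i with h | h
  · simpa using h
  · rw [cs.simple_mul_simple_cancel_left] at h
    exact absurd (hux.trans (h.trans hyw)) hu

theorem bruhatLE_and_iff_simple_mul (hu : ¬ BruhatLE cs (cs.simple i * u) w) (y : W) :
    (BruhatLE cs (cs.simple i * u) (cs.simple i * y) ∧
      BruhatLE cs (cs.simple i * y) (cs.simple i * w)) ↔ BruhatLE cs u y ∧ BruhatLE cs y w := by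
  constructor
  · rintro ⟨h1, h2⟩
    have hyw : BruhatLE cs y w := .of_simple_mul hu h1 .refl h2
    exact ⟨.of_simple_mul hu .refl hyw h1, hyw⟩
  · rintro ⟨h1, h2⟩
    exact ⟨.simple_mul_of_not_le hu .refl h1 h2, .simple_mul_of_not_le hu h1 h2 .refl⟩

/-- If `su ≰ w`, then left multiplication by `s` is an isomorphism from `[u,w]`
onto `[su,sw]`. -/
def bruhatIntervalTranslate (hu : ¬ BruhatLE cs (cs.simple i * u) w) :
    BruhatInterval cs u w ≃o BruhatInterval cs (cs.simple i * u) (cs.simple i * w) where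
  toFun y := ⟨cs.simple i * y.1, (bruhatLE_and_iff_simple_mul hu _).mpr y.2⟩
  invFun z := ⟨cs.simple i * z.1, (bruhatLE_and_iff_simple_mul hu _).mp
    (by simpa using z.2)⟩
  left_inv y := Subtype.ext (by simp)
  right_inv z := Subtype.ext (by simp)
  map_rel_iff' := by
    rintro ⟨x, hx⟩ ⟨y, hy⟩
    exact ⟨fun h => BruhatLE.of_simple_mul hu
        ((bruhatLE_and_iff_simple_mul hu _).mpr hx).1 hy.2 h,
      fun h => BruhatLE.simple_mul_of_not_le hu hx.1 h hy.2⟩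

theorem bruhatDeg_translate (hu : ¬ BruhatLE cs (cs.simple i * u) w) (v : W) :
    bruhatDeg cs (cs.simple i * u) (cs.simple i * w) (cs.simple i * v) = bruhatDeg cs u w v := by
  have hset : {z : W | (BruhatLE cs (cs.simple i * u) z ∧ BruhatLE cs z (cs.simple i * w)) ∧
      cs.IsReflection ((cs.simple i * v)⁻¹ * z)} = (cs.simple i * ·) '' {y : W |
        (BruhatLE cs u y ∧ BruhatLE cs y w) ∧ cs.IsReflection (v⁻¹ * y)} := by
    ext z
    obtain ⟨y, rfl⟩ : ∃ y, z = cs.simple i * y := ⟨cs.simple i * z, by simp⟩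
    rw [Function.Injective.mem_set_image (mul_right_injective (cs.simple i)), Set.mem_ofPred_eq,
      Set.mem_ofPred_eq, simple_mul_inv_mul, bruhatLE_and_iff_simple_mul hu]
  rw [bruhatDeg_eq_ncard, hset, Set.ncard_image_of_injective _ (mul_right_injective _),
    ← bruhatDeg_eq_ncard]

end Translate

/-! ### Special matchings -/

section SpecialMatching

theorem IsSpecialMatching.map {α β : Type*} [PartialOrder α] [PartialOrder β] (e : α ≃o β)
    {f : α → α} (hf : IsSpecialMatching f) :
    IsSpecialMatching (fun y => e (f (e.symm y))) := by
  obtain ⟨⟨h1, h2⟩, h3⟩ := hf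
  refine ⟨⟨fun y => ?_, fun y => ?_⟩, fun x y hxy => ?_⟩
  · simp [h1 (e.symm y)]
  · obtain ⟨x, rfl⟩ := e.surjective y
    simpa using h2 x
  · obtain ⟨x, rfl⟩ := e.surjective x
    obtain ⟨y, rfl⟩ := e.surjective y
    simpa using h3 x y (by simpa using hxy)

variable {cs : CoxeterSystem M W} {u w : W} {i : B}

theorem covBy_of_length_eq_succ {x y : BruhatInterval cs u w} (hxy : BruhatLE cs x.1 y.1)
    (hl : cs.length y.1 = cs.length x.1 + 1) : x ⋖ y := by
  have hlt : ∀ {a b : BruhatInterval cs u w}, a < b → cs.length a.1 < cs.length b.1 := fun h =>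
    BruhatLE.length_lt h.le fun e => h.ne (Subtype.ext e)
  refine ⟨lt_of_le_of_ne hxy ?_, fun z h1 h2 => ?_⟩
  · rintro rfl; omega
  · have := hlt h1
    have := hlt h2
    omega

/-- If `u < su` and `sw < w`, then left multiplication by `s` is a special matching of the dual
of `[u,w]`. -/
theorem exists_isSpecialMatching_of_descent (hus : BruhatLE cs u (cs.simple i * u))
    (hw : BruhatLE cs (cs.simple i * w) w) :
    ∃ f : (BruhatInterval cs u w)ᵒᵈ → (BruhatInterval cs u w)ᵒᵈ, IsSpecialMatching f := by
  let g : BruhatInterval cs u w → BruhatInterval cs u w := fun y =>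
    ⟨cs.simple i * y.1, y.2.1.simple_mul_right hus, y.2.2.simple_mul_left hw⟩
  have hinv : Function.Involutive g := fun y => Subtype.ext (by simp [g])
  have hcov : ∀ y, y ⋖ g y ∨ g y ⋖ y := by
    intro y
    rcases cs.length_simple_mul y.1 i with h | h
    · exact Or.inl (covBy_of_length_eq_succ (bruhatLE_simple_mul (by omega)) h)
    · exact Or.inr (covBy_of_length_eq_succ (simple_mul_bruhatLE (by omega)) h.symm)
  have hspecial : ∀ y x, y ⋖ x → g x = y ∨ g y < g x := by
    intro y x hyx
    have hle : BruhatLE cs y.1 x.1 := hyx.le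
    have hne : g y ≠ g x := fun h => hyx.ne (hinv.injective h)
    by_cases hyg : y ⋖ g y
    · by_cases hxg : g x ⋖ x
      · left
        have h1 : g y ≤ x := hle.simple_mul_left (i := i) hxg.le
        have h2 : g y = x := by_contra fun h => hyx.2 hyg.lt (lt_of_le_of_ne h1 h)
        rw [← h2, hinv y]
      · right
        have hxg' : x ⋖ g x := (hcov x).resolve_right hxg
        refine lt_of_le_of_ne ?_ hne
        exact (hle.simple_mul_or_left i).elim id (·.trans hxg'.le)
    · right
      have hyg' : g y ⋖ y := (hcov y).resolve_left hyg
      refine lt_of_le_of_ne ?_ hne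
      exact (hle.simple_mul_or_right i).elim id (Relation.ReflTransGen.trans hyg'.le)
  refine ⟨fun y => OrderDual.toDual (g (OrderDual.ofDual y)), ⟨hinv, fun y => ?_⟩,
    fun x y hxy => ?_⟩
  · rcases hcov (OrderDual.ofDual y) with h | h
    · exact Or.inl h.toDual
    · exact Or.inr h.toDual
  · exact hspecial _ _ hxy.ofDual

/-- The principal ideal of `x` in the dual of `[u,w]` is the dual of `[x,w]`. -/
def dualIdealIso (x : (BruhatInterval cs u w)ᵒᵈ) :
    (BruhatInterval cs (OrderDual.ofDual x).1 w)ᵒᵈ ≃o {v : (BruhatInterval cs u w)ᵒᵈ // v ≤ x} where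
  toFun y := ⟨OrderDual.toDual ⟨(OrderDual.ofDual y).1,
    (OrderDual.ofDual x).2.1.trans (OrderDual.ofDual y).2.1, (OrderDual.ofDual y).2.2⟩,
    (OrderDual.ofDual y).2.1⟩
  invFun v := OrderDual.toDual ⟨(OrderDual.ofDual v.1).1, v.2, (OrderDual.ofDual v.1).2.2⟩
  left_inv _ := rfl
  right_inv _ := rfl
  map_rel_iff' := Iff.rfl

end SpecialMatching

/-! ### The main induction -/

section MainInduction

variable {cs : CoxeterSystem M W}

/-- If every nontrivial smooth interval admits a simple reflection as in the hypothesis, then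
smoothness is inherited by upper subintervals, and the duals of nontrivial smooth intervals have
special matchings. -/
theorem smooth_upper_and_exists_isSpecialMatching [Finite W]
    (H : ∀ u w : W, BruhatLE cs u w → u ≠ w →
      bruhatDeg cs u w u = cs.length w - cs.length u →
      ∃ i : B, ¬ cs.IsLeftDescent u i ∧
        (¬ BruhatLE cs (cs.simple i * u) w ∨
          (BruhatLE cs (cs.simple i * w) w ∧ cs.simple i * w ≠ w)))
    {u w : W} (huw : BruhatLE cs u w) (hdeg : bruhatDeg cs u w u = cs.length w - cs.length u) :
    (∀ x, BruhatLE cs u x → BruhatLE cs x w →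
      bruhatDeg cs x w x = cs.length w - cs.length x) ∧
    (u ≠ w → ∃ f : (BruhatInterval cs u w)ᵒᵈ → (BruhatInterval cs u w)ᵒᵈ,
      IsSpecialMatching f) := by
  obtain ⟨L, hL⟩ := (Set.finite_range cs.length).bddAbove
  have hL : ∀ y, cs.length y ≤ L := fun y => hL ⟨y, rfl⟩
  induction hk : L - cs.length u using Nat.strong_induction_on generalizing u w with
  | _ k ih =>
  by_cases hne : u = w
  · subst hne
    refine ⟨fun x h1 h2 => ?_, fun h => absurd rfl h⟩
    rw [← h1.antisymm h2]
    exact hdeg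
  obtain ⟨i, hi, hor⟩ := H u w huw hne hdeg
  rw [cs.not_isLeftDescent_iff] at hi
  have hus : BruhatLE cs u (cs.simple i * u) := bruhatLE_simple_mul (by omega)
  have hLs := hL (cs.simple i * u)
  by_cases hu : BruhatLE cs (cs.simple i * u) w
  · have hw : BruhatLE cs (cs.simple i * w) w := (hor.resolve_left (not_not.mpr hu)).1
    have huw' := hu.length_le
    have hdeg' := bruhatDeg_eq_of_descent huw hus hw
    obtain ⟨ih1, -⟩ := ih _ (by omega) hu (by omega) rfl
    refine ⟨fun x h1 h2 => ?_, fun _ => exists_isSpecialMatching_of_descent hus hw⟩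
    by_cases hx : BruhatLE cs (cs.simple i * u) x
    · exact ih1 x hx h2
    have hxs : BruhatLE cs x (cs.simple i * x) :=
      (bruhatLE_simple_mul_total cs x i).resolve_right fun h => hx (h1.simple_mul_left h)
    have hsx : BruhatLE cs (cs.simple i * x) w := h2.simple_mul_left hw
    have hlen := hxs.length_lt (simple_mul_ne cs x i).symm
    have hlen' := cs.length_simple_mul x i
    have hlen'' := hsx.length_le
    have hux := (h1.simple_mul_or_left i).resolve_right hx
    rw [bruhatDeg_eq_of_descent h2 hxs hw, ih1 _ hux hsx]
    omega
  · have hlen : ∀ x, BruhatLE cs u x → BruhatLE cs x w →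
        cs.length (cs.simple i * x) = cs.length x + 1 := by
      intro x h1 h2
      refine (cs.length_simple_mul x i).resolve_right fun h => hu ?_
      exact (h1.simple_mul_left (simple_mul_bruhatLE (by omega))).trans h2
    have hw := hlen w huw .refl
    obtain ⟨hsw, -⟩ := (bruhatLE_and_iff_simple_mul hu w).mpr ⟨huw, .refl⟩
    obtain ⟨ih1, ih2⟩ := ih _ (by omega) hsw
      (by rw [bruhatDeg_translate hu, hdeg]; omega) rfl
    refine ⟨fun x h1 h2 => ?_, fun _ => ?_⟩
    · have hx := hlen x h1 h2
      obtain ⟨h3, h4⟩ := (bruhatLE_and_iff_simple_mul hu x).mpr ⟨h1, h2⟩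
      have := ih1 _ h3 h4
      rw [bruhatDeg_translate fun h => hu (h3.trans h)] at this
      omega
    · obtain ⟨f, hf⟩ := ih2 fun h => hne (mul_left_cancel h)
      exact ⟨_, hf.map (bruhatIntervalTranslate hu).symm.dual⟩

end MainInduction

/-- Suppose that for every smooth Bruhat interval `[u,w]` in the symmetric
group `S_(n+1)` (type `Aₙ`) there is a simple reflection `s ∉ D_L(u)` with `su ≰ w` or
`sw < w`. Then for every smooth Bruhat interval `[u,w]` in `S_(n+1)`, the dual poset
`[u,w]*` is a zircon. -/
theorem conjC4_implies_conjC3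
    {W : Type*} [Group W] {n : ℕ} (hn : 1 ≤ n)
    (cs : CoxeterSystem (CoxeterMatrix.Aₙ n) W)
    (H : ∀ u w : W, BruhatLE cs u w → u ≠ w →
      bruhatDeg cs u w u = cs.length w - cs.length u →
      ∃ i : Fin n, ¬ cs.IsLeftDescent u i ∧
        (¬ BruhatLE cs (cs.simple i * u) w ∨
          (BruhatLE cs (cs.simple i * w) w ∧ cs.simple i * w ≠ w))) :
    ∀ u w : W, BruhatLE cs u w → u ≠ w →
      bruhatDeg cs u w u = cs.length w - cs.length u →
      IsZircon ((BruhatInterval cs u w)ᵒᵈ) := by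
  have := finite_of_coxeterSystem_A cs
  intro u w huw _ hdeg x ⟨y, hyx⟩
  refine ⟨Set.toFinite _, ?_⟩
  have hx := (OrderDual.ofDual x).2
  have hxdeg := (smooth_upper_and_exists_isSpecialMatching H huw hdeg).1 _ hx.1 hx.2
  have hxw : (OrderDual.ofDual x).1 ≠ w := by
    intro h
    have hxy : BruhatLE cs (OrderDual.ofDual x).1 (OrderDual.ofDual y).1 := hyx.le
    have hlt := hxy.length_lt fun e => hyx.ne (Subtype.ext e.symm)
    rw [h] at hlt
    exact absurd (OrderDual.ofDual y).2.2.length_le (not_le.mpr hlt)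
  obtain ⟨f, hf⟩ := (smooth_upper_and_exists_isSpecialMatching H hx.2 hxdeg).2 hxw
  exact ⟨_, hf.map (dualIdealIso x)⟩

end Paper
end

section
/- Fix n ≥ 1 and suppose that for every smooth Bruhat interval [u,w] in the symmetric group S_{n+1} there exists s ∈ S ∖ D_L(u) such that either su ≰ w or sw < w. Then for every Bruhat interval [u,w] in S_{n+1} which is a zircon, there exists s ∈ D_L(w) such that either sw ≱ u or su > u. -/
namespace Paper

/-! ### Bruhat order on a Coxeter group -/

variable {B W : Type*} [Group W] {M : CoxeterMatrix B}

section SymmetricGroup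

set_option linter.deprecated false

open Equiv

section Swaps

variable {α : Type*} [DecidableEq α]

/-- A transposition is determined by any point it moves. -/
theorem isSwap_eq_swap_apply {σ : Perm α} (h : σ.IsSwap) {x : α} (hx : σ x ≠ x) :
    σ = swap x (σ x) := by
  obtain ⟨a, b, -, rfl⟩ := h
  rcases eq_or_ne x a with rfl | ha
  · rw [swap_apply_left]
  rcases eq_or_ne x b with rfl | hb
  · rw [swap_apply_right, swap_comm]
  · exact absurd (swap_apply_of_ne_of_ne ha hb) hx

theorem isSwap_mul_self {σ : Perm α} (h : σ.IsSwap) : σ * σ = 1 := by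
  obtain ⟨a, b, -, rfl⟩ := h
  exact swap_mul_self a b

theorem isSwap_inv_eq {σ : Perm α} (h : σ.IsSwap) : σ⁻¹ = σ :=
  inv_eq_of_mul_eq_one_left (isSwap_mul_self h)

theorem isSwap_conj {σ : Perm α} (h : σ.IsSwap) (g : Perm α) : (g * σ * g⁻¹).IsSwap := by
  obtain ⟨a, b, hab, rfl⟩ := h
  exact ⟨g a, g b, g.injective.ne hab, by rw [mul_swap_eq_swap_mul, mul_inv_cancel_right]⟩

theorem exists_eq_swap_apply_of_mul_isSwap {p q : Perm α} (hp : p.IsSwap) (hq : q.IsSwap)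
    (hne : p * q ≠ 1) : ∃ x, (p * q) x ≠ x ∧ p = swap x ((p * q) x) := by
  have key : ∀ x, p x ≠ x → q x = x → ∃ x, (p * q) x ≠ x ∧ p = swap x ((p * q) x) := by
    intro x h1 h2
    refine ⟨x, ?_, ?_⟩ <;> rw [Perm.mul_apply, h2]
    · exact h1
    · exact isSwap_eq_swap_apply hp h1
  obtain ⟨a, b, hab, rfl⟩ := id hp
  by_cases h1 : q a = a
  · exact key a (by simpa using hab.symm) h1
  by_cases h2 : q b = b
  · exact key b (by simpa using hab) h2
  exfalso
  by_cases h3 : q a = b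
  · exact hne (by rw [isSwap_eq_swap_apply hq h1, h3, swap_mul_self])
  · have := isSwap_eq_swap_apply hq h1
    exact h2 (by rw [this, swap_apply_of_ne_of_ne hab.symm (Ne.symm h3)])

/-- The factorizations of a product of two distinct transpositions. -/
theorem isSwap_factor {p p' r q : Perm α} (hp : p.IsSwap) (hp' : p'.IsSwap) (hr : r.IsSwap)
    (hq : q.IsSwap) (hrq : r ≠ q) (h : p * p' = r * q) : p = r ∨ p = q ∨ p = r * q * r := by
  have hne : p * p' ≠ 1 := by
    rw [h]
    intro h1
    exact hrq (by rw [eq_inv_of_mul_eq_one_left h1, isSwap_inv_eq hq])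
  obtain ⟨x, hx, hpx⟩ := exists_eq_swap_apply_of_mul_isSwap hp hp' hne
  rw [h, Perm.mul_apply] at hx hpx
  by_cases h1 : q x = x
  · rw [h1] at hx hpx
    exact .inl (hpx.trans (isSwap_eq_swap_apply hr hx).symm)
  by_cases h2 : r (q x) = q x
  · rw [h2] at hpx
    exact .inr (.inl (hpx.trans (isSwap_eq_swap_apply hq h1).symm))
  · refine .inr (.inr ?_)
    have hrx : r x = x := by
      rw [isSwap_eq_swap_apply hr h2]
      exact swap_apply_of_ne_of_ne (Ne.symm h1) (Ne.symm hx)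
    have hq' := isSwap_eq_swap_apply hq h1
    calc p = swap (r x) (r (q x)) := by rw [hrx]; exact hpx
      _ = r * swap x (q x) * r⁻¹ := by rw [mul_swap_eq_swap_mul, mul_inv_cancel_right]
      _ = r * q * r := by rw [← hq', isSwap_inv_eq hr]

theorem isSwap_common_neighbour {r q d : Perm α} (hr : r.IsSwap) (hq : q.IsSwap) (hrq : r ≠ q)
    (h1 : (r⁻¹ * d).IsSwap) (h2 : (q⁻¹ * d).IsSwap) (hd : d ≠ 1) : d = q * r ∨ d = r * q := by
  rw [isSwap_inv_eq hr] at h1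
  rw [isSwap_inv_eq hq] at h2
  have hrr := isSwap_mul_self hr
  have hqq := isSwap_mul_self hq
  have h3 : q * d * (r * d) = q * r := by
    have h4 := isSwap_inv_eq h1
    rw [← h4, mul_inv_rev, isSwap_inv_eq hr]
    group
  have hdq : d = q * (q * d) := by rw [← mul_assoc, hqq, one_mul]
  rcases isSwap_factor h2 h1 hq hr hrq.symm h3 with h | h | h
  · exact absurd (by rw [hdq, h, hqq]) hd
  · exact .inl (by rw [hdq, h])
  · exact .inr (by rw [hdq, h, ← mul_assoc, ← mul_assoc, hqq, one_mul])

theorem isSwap_of_square_one {r q d₁ d₂ y : Perm α} (hr : r.IsSwap) (hq : q.IsSwap) (hrq : r ≠ q)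
    (hr1 : (r⁻¹ * d₁).IsSwap) (hq1 : (q⁻¹ * d₁).IsSwap) (hr2 : (r⁻¹ * d₂).IsSwap)
    (hq2 : (q⁻¹ * d₂).IsSwap) (h1 : d₁ ≠ 1) (h2 : d₂ ≠ 1) (h12 : d₁ ≠ d₂)
    (hy1 : (d₁⁻¹ * y).IsSwap) (hy2 : (d₂⁻¹ * y).IsSwap) : y.IsSwap := by
  wlog h : d₁ = q * r generalizing r q
  · exact this hq hr hrq.symm hq1 hr1 hq2 hr2
      ((isSwap_common_neighbour hr hq hrq hr1 hq1 h1).resolve_left h)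
  have h' : d₂ = r * q := (isSwap_common_neighbour hr hq hrq hr2 hq2 h2).resolve_left
    (fun hh => h12 (h.trans hh.symm))
  subst h h'
  have hrr := isSwap_mul_self hr
  have hri := isSwap_inv_eq hr
  have hqi := isSwap_inv_eq hq
  have hrqr : (r * q * r).IsSwap := by
    have := isSwap_conj hq r
    rwa [hri] at this
  have hne : r * q * r ≠ q := by
    intro hh
    apply h12
    calc q * r = r * q * r * r := by rw [hh]
      _ = r * q := by rw [mul_assoc, hrr, mul_one]
  have h3 : (q * r)⁻¹ * y * ((r * q)⁻¹ * y) = r * q * r * q := by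
    rw [← isSwap_inv_eq hy2]
    simp only [mul_inv_rev, hri, hqi]
    group
  have hy : y = q * r * ((q * r)⁻¹ * y) := by group
  rcases isSwap_factor hy1 hy2 hrqr hq hne h3 with hh | hh | hh
  · rw [hy, hh]
    have : q * r * (r * q * r) = r := by
      nth_rw 1 [← hqi]
      nth_rw 2 [← hri]
      group
    rwa [this]
  · rw [hy, hh]
    have := isSwap_conj hr q
    rwa [hqi] at this
  · rw [hy, hh]
    have : q * r * (r * q * r * q * (r * q * r)) = r * q * r * (r * q)⁻¹ := by
      calc _ = q * (r * r) * q * (r * q * r * q * r) := by simp only [mul_assoc]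
        _ = r * q * r * (r * q)⁻¹ := by
          rw [hrr, mul_one, isSwap_mul_self hq, one_mul, mul_inv_rev, hri, hqi]
          simp only [mul_assoc]
    rw [this]
    exact isSwap_conj hr _

/-- If three vertices of the Cayley graph of the transpositions have two common neighbours, then
every common neighbour of two of them is adjacent to the third. -/
theorem isSwap_of_three_common {x c₁ c₂ d₁ d₂ y : Perm α} (hc : c₁ ≠ c₂)
    (h1 : x ≠ d₁) (h2 : x ≠ d₂) (h12 : d₁ ≠ d₂)
    (hxc1 : (x⁻¹ * c₁).IsSwap) (hxc2 : (x⁻¹ * c₂).IsSwap)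
    (h11 : (c₁⁻¹ * d₁).IsSwap) (h21 : (c₂⁻¹ * d₁).IsSwap)
    (h12' : (c₁⁻¹ * d₂).IsSwap) (h22 : (c₂⁻¹ * d₂).IsSwap)
    (hy1 : (d₁⁻¹ * y).IsSwap) (hy2 : (d₂⁻¹ * y).IsSwap) : (x⁻¹ * y).IsSwap := by
  have key : ∀ a b : Perm α, (x⁻¹ * a)⁻¹ * (x⁻¹ * b) = a⁻¹ * b := fun a b => by group
  refine isSwap_of_square_one hxc1 hxc2 (d₁ := x⁻¹ * d₁) (d₂ := x⁻¹ * d₂)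
    (fun h => hc (mul_left_cancel h)) ?_ ?_ ?_ ?_ ?_ ?_ (fun h => h12 (mul_left_cancel h)) ?_ ?_
  all_goals first | rw [key]; assumption | skip
  · rwa [Ne, inv_mul_eq_one]
  · rwa [Ne, inv_mul_eq_one]

end Swaps

section Length

variable {n : ℕ}

/-- `L` behaves under right multiplication by adjacent transpositions as the number of
inversions does. -/
def IsInversionLength (L : Perm (Fin (n + 1)) → ℕ) : Prop :=
  ∀ (σ : Perm (Fin (n + 1))) (i : Fin n), σ i.castSucc < σ i.succ →
    L (σ * swap i.castSucc i.succ) = L σ + 1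

variable {L : Perm (Fin (n + 1)) → ℕ}

theorem IsInversionLength.of_gt (hL : IsInversionLength L) (σ : Perm (Fin (n + 1))) (i : Fin n)
    (h : σ i.succ < σ i.castSucc) : L (σ * swap i.castSucc i.succ) + 1 = L σ := by
  have := hL (σ * swap i.castSucc i.succ) i (by simpa using h)
  rw [mul_assoc, swap_mul_self, mul_one] at this
  exact this.symm

theorem IsInversionLength.lt_mul_swap_aux (hL : IsInversionLength L) (d : ℕ) :
    ∀ (i j : Fin (n + 1)) (σ : Perm (Fin (n + 1))), i.val + d + 1 = j.val → σ i < σ j →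
      L σ < L (σ * swap i j) ∧
        ((∀ k, i < k → k < j → ¬ (σ i < σ k ∧ σ k < σ j)) → L (σ * swap i j) = L σ + 1) := by
  induction d with
  | zero =>
    intro i j σ hij hσ
    obtain ⟨i, rfl⟩ : ∃ i' : Fin n, i'.castSucc = i := ⟨⟨i, by omega⟩, rfl⟩
    obtain rfl : i.succ = j := Fin.ext (by simpa using hij)
    have := hL σ i hσ
    exact ⟨by omega, fun _ => this⟩
  | succ d ih =>
    intro i j σ hij hσ
    obtain ⟨i, rfl⟩ : ∃ i' : Fin n, i'.castSucc = i := ⟨⟨i, by omega⟩, rfl⟩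
    simp only [Fin.val_castSucc] at hij
    have hik : i.castSucc ≠ i.succ := i.castSucc_lt_succ.ne
    have hkj : i.succ ≠ j := fun h => by
      have := congrArg Fin.val h
      simp at this; omega
    have hi_j : i.castSucc ≠ j := fun h => by
      have := congrArg Fin.val h
      simp at this; omega
    set s := swap i.castSucc i.succ with hs
    have hsj : s j = j := swap_apply_of_ne_of_ne hi_j.symm hkj.symm
    have hsi : s i.castSucc = i.succ := swap_apply_left _ _
    have hsk : s i.succ = i.castSucc := swap_apply_right _ _
    have hst : swap i.castSucc j = s * swap i.succ j * s := by
      have : s * swap i.succ j * s⁻¹ = swap (s i.succ) (s j) := by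
        rw [mul_swap_eq_swap_mul, mul_inv_cancel_right]
      rw [hsj, hsk] at this
      rw [← this, hs, swap_inv]
    have hmid := ih i.succ j (σ * s) (by simp; omega)
      (by simpa only [Perm.mul_apply, hsj, hsk] using hσ)
    have hexact : (∀ k, i.castSucc < k → k < j → ¬ (σ i.castSucc < σ k ∧ σ k < σ j)) →
        L (σ * s * swap i.succ j) = L (σ * s) + 1 := by
      intro h
      apply hmid.2
      intro k h1 h2
      have h3 : i.castSucc < k := i.castSucc_lt_succ.trans h1
      have h4 : s k = k := swap_apply_of_ne_of_ne h3.ne' h1.ne'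
      simp only [Perm.mul_apply, hsj, hsk, h4]
      exact h k h3 h2
    have hti : swap i.succ j i.castSucc = i.castSucc := swap_apply_of_ne_of_ne hik hi_j
    have hi' : (σ * s * swap i.succ j) i.castSucc = σ i.succ := by
      simp only [Perm.mul_apply, hti, hsi]
    have hk' : (σ * s * swap i.succ j) i.succ = σ j := by
      simp only [Perm.mul_apply, swap_apply_left, hsj]
    have hassoc : σ * swap i.castSucc j = σ * s * swap i.succ j * s := by
      rw [hst]; simp only [mul_assoc]
    rw [hassoc]
    have hmid1 := hmid.1
    rcases lt_or_gt_of_ne (σ.injective.ne hik) with h1 | h1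
    · have e1 := hL σ i h1
      rcases lt_or_gt_of_ne (σ.injective.ne hkj) with h2 | h2
      · have e2 := hL (σ * s * swap i.succ j) i (by rwa [hi', hk'])
        rw [← hs] at e1 e2
        exact ⟨by omega, fun h => absurd ⟨h1, h2⟩ (h i.succ i.castSucc_lt_succ
          (Fin.lt_def.2 (by simp; omega)))⟩
      · have e2 := hL.of_gt (σ * s * swap i.succ j) i (by rwa [hi', hk'])
        rw [← hs] at e1 e2
        exact ⟨by omega, fun h => by have := hexact h; omega⟩
    · have e1 := hL.of_gt σ i h1
      have e2 := hL (σ * s * swap i.succ j) i (by rw [hi', hk']; exact h1.trans hσ)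
      rw [← hs] at e1 e2
      exact ⟨by omega, fun h => by have := hexact h; omega⟩

theorem IsInversionLength.lt_mul_swap (hL : IsInversionLength L) {i j : Fin (n + 1)}
    {σ : Perm (Fin (n + 1))} (hij : i < j) (hσ : σ i < σ j) : L σ < L (σ * swap i j) :=
  (hL.lt_mul_swap_aux (j.val - i.val - 1) i j σ (by have := Fin.lt_def.1 hij; omega) hσ).1

theorem IsInversionLength.exists_between (hL : IsInversionLength L) {i j : Fin (n + 1)}
    {σ : Perm (Fin (n + 1))} (hij : i < j) (hσ : σ i < σ j)
    (hne : L (σ * swap i j) ≠ L σ + 1) : ∃ k, i < k ∧ k < j ∧ σ i < σ k ∧ σ k < σ j := by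
  by_contra! h
  refine hne ((hL.lt_mul_swap_aux (j.val - i.val - 1) i j σ
    (by have := Fin.lt_def.1 hij; omega) hσ).2 fun k h1 h2 h3 => ?_)
  exact absurd h3.2 (not_lt.2 (h k h1 h2 h3.1))

theorem IsInversionLength.lt_mul_swap_iff (hL : IsInversionLength L) {i j : Fin (n + 1)}
    {σ : Perm (Fin (n + 1))} (hij : i ≠ j) :
    L σ < L (σ * swap i j) ↔ (i < j ↔ σ i < σ j) := by
  wlog h : i < j generalizing i j
  · have hji := lt_of_le_of_ne (not_lt.1 h) hij.symm
    rw [swap_comm, this hij.symm hji]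
    have := σ.injective.ne hij
    grind
  simp only [h, true_iff]
  refine ⟨fun h1 => ?_, fun h1 => hL.lt_mul_swap h h1⟩
  by_contra h2
  have h3 : σ j < σ i := lt_of_le_of_ne (not_lt.1 h2) (σ.injective.ne hij.symm)
  have := hL.lt_mul_swap (σ := σ * swap i j) h (by simpa using h3)
  rw [mul_assoc, swap_mul_self, mul_one] at this
  omega

/-- Every Bruhat edge which is not a covering relation lies in a hexagon of shorter edges. -/
theorem IsInversionLength.exists_hexagon (hL : IsInversionLength L) {x y : Perm (Fin (n + 1))}
    (hxy : (x⁻¹ * y).IsSwap) (hlt : L x < L y) (hne : L y ≠ L x + 1) :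
    ∃ c₁ c₂ d₁ d₂, c₁ ≠ c₂ ∧ d₁ ≠ d₂ ∧ L x < L c₁ ∧ L x < L c₂ ∧ L c₁ < L d₁ ∧ L c₁ < L d₂ ∧
      L c₂ < L d₁ ∧ L c₂ < L d₂ ∧ L d₁ < L y ∧ L d₂ < L y ∧
      (x⁻¹ * c₁).IsSwap ∧ (x⁻¹ * c₂).IsSwap ∧ (c₁⁻¹ * d₁).IsSwap ∧ (c₂⁻¹ * d₁).IsSwap ∧
      (c₁⁻¹ * d₂).IsSwap ∧ (c₂⁻¹ * d₂).IsSwap ∧ (d₁⁻¹ * y).IsSwap ∧ (d₂⁻¹ * y).IsSwap := by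
  obtain ⟨i, j, hij, hs⟩ := hxy
  obtain rfl : y = x * swap i j := by rw [← hs]; group
  clear hs
  wlog h : i < j generalizing i j
  · have hji := lt_of_le_of_ne (not_lt.1 h) hij.symm
    rw [swap_comm] at hlt hne ⊢
    exact this j i hij.symm hlt hne hji
  have hσ : x i < x j := by simpa [h] using (hL.lt_mul_swap_iff hij).1 hlt
  obtain ⟨k, hik, hkj, h1, h2⟩ := hL.exists_between h hσ hne
  have e1 : x * swap i k * swap k j = x * swap k j * swap i j := by
    rw [mul_assoc, mul_assoc]
    congr 1
    ext m
    simp only [Perm.mul_apply, swap_apply_def]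
    grind
  have e2 : x * swap i k * swap i j = x * swap k j * swap i k := by
    rw [mul_assoc, mul_assoc]
    congr 1
    ext m
    simp only [Perm.mul_apply, swap_apply_def]
    grind
  have e3 : x * swap i j = x * swap i k * swap k j * swap i k := by
    rw [mul_assoc, mul_assoc]
    congr 1
    ext m
    simp only [Perm.mul_apply, swap_apply_def]
    grind
  have e4 : x * swap i j = x * swap i k * swap i j * swap k j := by
    rw [mul_assoc, mul_assoc]
    congr 1
    ext m
    simp only [Perm.mul_apply, swap_apply_def]
    grind
  have sw : ∀ (a : Perm (Fin (n + 1))) {p q : Fin (n + 1)}, p ≠ q →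
      (a⁻¹ * (a * swap p q)).IsSwap := fun a p q hpq => by
    rw [inv_mul_cancel_left]; exact ⟨p, q, hpq, rfl⟩
  refine ⟨x * swap i k, x * swap k j, x * swap i k * swap k j, x * swap i k * swap i j,
    ?_, ?_, ?_, ?_, ?_, ?_, ?_, ?_, ?_, ?_, sw _ hik.ne, sw _ hkj.ne, sw _ hkj.ne, ?_,
    sw _ hij, ?_, ?_, ?_⟩
  · intro he
    have := congrArg (fun g : Perm _ => g i) (mul_left_cancel he)
    simp [swap_apply_def] at this
    grind
  · intro he
    have := congrArg (fun g : Perm _ => g i) (mul_left_cancel he)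
    simp [swap_apply_def] at this
    grind
  · exact hL.lt_mul_swap hik h1
  · exact hL.lt_mul_swap hkj h2
  · refine hL.lt_mul_swap hkj ?_
    simp only [Perm.mul_apply, swap_apply_def]
    grind
  · refine hL.lt_mul_swap h ?_
    simp only [Perm.mul_apply, swap_apply_def]
    grind
  · rw [e1]
    refine hL.lt_mul_swap h ?_
    simp only [Perm.mul_apply, swap_apply_def]
    grind
  · rw [e2]
    refine hL.lt_mul_swap hik ?_
    simp only [Perm.mul_apply, swap_apply_def]
    grind
  · rw [e3]
    refine hL.lt_mul_swap hik ?_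
    simp only [Perm.mul_apply, swap_apply_def]
    grind
  · rw [e4]
    refine hL.lt_mul_swap hkj ?_
    simp only [Perm.mul_apply, swap_apply_def]
    grind
  · rw [e1]; exact sw _ hij
  · rw [e2]; exact sw _ hik.ne
  · rw [e3]; exact sw _ hik.ne
  · rw [e4]; exact sw _ hkj.ne

/-- Every directed path of length two in the Bruhat graph has a companion with the same end
points. -/
theorem IsInversionLength.exists_diamond (hL : IsInversionLength L) {a b c : Perm (Fin (n + 1))}
    (hab : (a⁻¹ * b).IsSwap) (hbc : (b⁻¹ * c).IsSwap) (h1 : L a < L b) (h2 : L b < L c) :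
    ∃ b', b' ≠ b ∧ (a⁻¹ * b').IsSwap ∧ (b'⁻¹ * c).IsSwap ∧ L a < L b' ∧ L b' < L c := by
  obtain ⟨i, j, hij, hs⟩ := hab
  obtain rfl : b = a * swap i j := by rw [← hs]; group
  obtain ⟨k, l, hkl, hs'⟩ := hbc
  obtain rfl : c = a * swap i j * swap k l := by rw [← hs']; group
  clear hs hs'
  have sw : ∀ (a : Perm (Fin (n + 1))) {p q : Fin (n + 1)}, p ≠ q →
      (a⁻¹ * (a * swap p q)).IsSwap := fun a p q hpq => by
    rw [inv_mul_cancel_left]; exact ⟨p, q, hpq, rfl⟩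
  have shared : ∀ i j l : Fin (n + 1), i ≠ j → i ≠ l → L a < L (a * swap i j) →
      L (a * swap i j) < L (a * swap i j * swap i l) →
      ∃ b', b' ≠ a * swap i j ∧ (a⁻¹ * b').IsSwap ∧ (b'⁻¹ * (a * swap i j * swap i l)).IsSwap ∧
        L a < L b' ∧ L b' < L (a * swap i j * swap i l) := by
    intro i j l hij hil h1 h2
    have hjl : j ≠ l := by
      rintro rfl
      rw [mul_assoc, swap_mul_self, mul_one] at h2
      omega
    have e1 : a * swap i j * swap i l = a * swap i l * swap l j := by
      rw [mul_assoc, mul_assoc]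
      congr 1
      ext m
      simp only [Perm.mul_apply, swap_apply_def]
      grind
    have e2 : a * swap i j * swap i l = a * swap j l * swap i j := by
      rw [mul_assoc, mul_assoc]
      congr 1
      ext m
      simp only [Perm.mul_apply, swap_apply_def]
      grind
    have n1 : a * swap i l ≠ a * swap i j := by
      intro he
      have := congrArg (fun g : Perm _ => g i) (mul_left_cancel he)
      simp at this
      exact hjl this.symm
    have n2 : a * swap j l ≠ a * swap i j := by
      intro he
      have := congrArg (fun g : Perm _ => g i) (mul_left_cancel he)
      simp [swap_apply_def] at this
      grind
    have c1 : L a < L (a * swap i l) ∧ L (a * swap i l) < L (a * swap i l * swap l j) ∨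
        L a < L (a * swap j l) ∧ L (a * swap j l) < L (a * swap j l * swap i j) := by
      rw [hL.lt_mul_swap_iff hij] at h1 ⊢
      rw [hL.lt_mul_swap_iff hil] at h2 ⊢
      rw [hL.lt_mul_swap_iff hjl.symm, hL.lt_mul_swap_iff hjl]
      have v1 := a.injective.ne hij
      have v2 := a.injective.ne hil
      have v3 := a.injective.ne hjl
      have w1 : swap i j i = j := swap_apply_left _ _
      have w2 : swap i j l = l := swap_apply_of_ne_of_ne hil.symm hjl.symm
      have w3 : swap i l l = i := swap_apply_right _ _
      have w4 : swap i l j = j := swap_apply_of_ne_of_ne hij.symm hjl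
      have w5 : swap j l i = i := swap_apply_of_ne_of_ne hij hil
      have w6 : swap j l j = l := swap_apply_left _ _
      simp only [Perm.mul_apply, w1, w2, w3, w4, w5, w6] at h1 h2 ⊢
      simp only [Fin.lt_def, Ne, Fin.ext_iff] at *
      omega
    rcases c1 with ⟨c1, c2⟩ | ⟨c1, c2⟩
    · exact ⟨_, n1, sw _ hil, by rw [e1]; exact sw _ hjl.symm, c1, by rwa [e1]⟩
    · exact ⟨_, n2, sw _ hjl, by rw [e2]; exact sw _ hij, c1, by rwa [e2]⟩
  rcases eq_or_ne k i with rfl | hki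
  · exact shared k j l hij hkl h1 h2
  rcases eq_or_ne l i with rfl | hli
  · rw [swap_comm k l] at h2 ⊢
    exact shared l j k hij hkl.symm h1 h2
  rcases eq_or_ne k j with rfl | hkj
  · rw [swap_comm i k] at h1 h2 ⊢
    exact shared k i l hij.symm hkl h1 h2
  rcases eq_or_ne l j with rfl | hlj
  · rw [swap_comm i l] at h1 h2 ⊢
    rw [swap_comm k l] at h2 ⊢
    exact shared l i k hij.symm hkl.symm h1 h2
  have e1 : a * swap i j * swap k l = a * swap k l * swap i j := by
    rw [mul_assoc, mul_assoc]
    congr 1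
    ext m
    simp only [Perm.mul_apply, swap_apply_def]
    grind
  have w1 : swap i j k = k := swap_apply_of_ne_of_ne hki hkj
  have w2 : swap i j l = l := swap_apply_of_ne_of_ne hli hlj
  have w3 : swap k l i = i := swap_apply_of_ne_of_ne hki.symm hli.symm
  have w4 : swap k l j = j := swap_apply_of_ne_of_ne hkj.symm hlj.symm
  refine ⟨a * swap k l, ?_, sw _ hkl, by rw [e1]; exact sw _ hij, ?_, ?_⟩
  · intro he
    have := congrArg (fun g : Perm _ => g k) (mul_left_cancel he)
    simp [w1] at this
    exact hkl this.symm
  · rw [hL.lt_mul_swap_iff hkl] at h2 ⊢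
    simpa only [Perm.mul_apply, w1, w2] using h2
  · rw [e1]
    rw [hL.lt_mul_swap_iff hij] at h1 ⊢
    simpa only [Perm.mul_apply, w3, w4] using h1

/-- Right multiplication by the longest element complements the length. -/
theorem IsInversionLength.exists_complement (hL : IsInversionLength L) :
    ∃ (g : Perm (Fin (n + 1))) (c : ℕ), ∀ σ, L σ + L (σ * g) = c := by
  refine ⟨Fin.revPerm, L 1 + L (1 * Fin.revPerm), fun σ => ?_⟩
  have hσ : σ ∈ Submonoid.closure (Set.range fun i : Fin n => swap i.castSucc i.succ) := by
    rw [Perm.mclosure_swap_castSucc_succ]; trivial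
  induction hσ using Submonoid.closure_induction_right with
  | one => rfl
  | mul_right σ hσ s hs ih =>
    obtain ⟨i, rfl⟩ := hs
    rw [← ih]
    have e : σ * swap i.castSucc i.succ * Fin.revPerm =
        σ * Fin.revPerm * swap i.rev.castSucc i.rev.succ := by
      rw [mul_assoc, mul_assoc, mul_swap_eq_swap_mul]
      simp [Fin.rev_castSucc, Fin.rev_succ, swap_comm]
    simp only
    rw [e]
    rcases lt_or_gt_of_ne (σ.injective.ne i.castSucc_lt_succ.ne) with h | h
    · have h1 := hL σ i h
      have h2 := hL.of_gt (σ * Fin.revPerm) i.rev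
        (by simpa [Fin.rev_castSucc, Fin.rev_succ] using h)
      omega
    · have h1 := hL.of_gt σ i h
      have h2 := hL (σ * Fin.revPerm) i.rev
        (by simpa [Fin.rev_castSucc, Fin.rev_succ] using h)
      omega

end Length

section TypeA

variable {W : Type*} [Group W] {n : ℕ} (cs : CoxeterSystem (CoxeterMatrix.Aₙ n) W)

theorem matrix_apply (i j : Fin n) : (CoxeterMatrix.Aₙ n).M i j =
    if i = j then 1 else if j.val + 1 = i.val ∨ i.val + 1 = j.val then 3 else 2 := rfl

theorem isLiftable_swap (n : ℕ) : (CoxeterMatrix.Aₙ n).IsLiftable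
    (fun i : Fin n => swap i.castSucc i.succ) := by
  have h3 : ∀ a b c : Fin (n + 1), a ≠ b → b ≠ c → a ≠ c → (swap a b * swap b c) ^ 3 = 1 := by
    intro a b c hab hbc hac
    ext m
    simp only [pow_succ, pow_zero, one_mul, Perm.mul_apply, swap_apply_def, Perm.one_apply]
    grind
  intro i j
  rw [matrix_apply]
  change (swap i.castSucc i.succ * swap j.castSucc j.succ) ^ _ = 1
  split_ifs with h1 h2
  · subst h1
    rw [pow_one, swap_mul_self]
  · rcases h2 with h2 | h2
    · have e : j.succ = i.castSucc := Fin.ext (by simpa using h2)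
      rw [← e, swap_comm j.succ i.succ, swap_comm j.castSucc j.succ]
      refine h3 _ _ _ ?_ ?_ ?_ <;>
        simp only [Ne, Fin.ext_iff, Fin.val_castSucc, Fin.val_succ] <;> omega
    · have e : i.succ = j.castSucc := Fin.ext (by simpa using h2)
      rw [← e]
      refine h3 _ _ _ ?_ ?_ ?_ <;>
        simp only [Ne, Fin.ext_iff, Fin.val_castSucc, Fin.val_succ] <;> omega
  · have hd : Perm.Disjoint (swap i.castSucc i.succ) (swap j.castSucc j.succ) := by
      intro m
      simp only [swap_apply_def, Fin.ext_iff, Fin.val_castSucc, Fin.val_succ] at *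
      grind
    rw [hd.commute.mul_pow, pow_two, pow_two, swap_mul_self, swap_mul_self, one_mul]

/-- The permutation representation of the Coxeter group of type `Aₙ`. -/
noncomputable def toPerm : W →* Perm (Fin (n + 1)) :=
  cs.lift ⟨fun i : Fin n => swap i.castSucc i.succ, isLiftable_swap n⟩

theorem toPerm_simple (i : Fin n) : toPerm cs (cs.simple i) = swap i.castSucc i.succ :=
  cs.lift_apply_simple (isLiftable_swap n) i

theorem simple_commute {i j : Fin n} (hij : i ≠ j)
    (h : ¬ (i.val + 1 = j.val ∨ j.val + 1 = i.val)) :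
    cs.simple i * cs.simple j = cs.simple j * cs.simple i := by
  have h1 := cs.simple_mul_simple_pow i j
  have h2 : (CoxeterMatrix.Aₙ n).M i j = 2 := by
    rw [matrix_apply, if_neg hij, if_neg (by tauto)]
  rw [h2, pow_two] at h1
  have := eq_inv_of_mul_eq_one_left h1
  rwa [mul_inv_rev, cs.inv_simple, cs.inv_simple] at this

theorem simple_braid {i j : Fin n} (hij : i ≠ j) (h : i.val + 1 = j.val ∨ j.val + 1 = i.val) :
    cs.simple i * cs.simple j * cs.simple i = cs.simple j * cs.simple i * cs.simple j := by
  have h1 := cs.simple_mul_simple_pow i j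
  have h2 : (CoxeterMatrix.Aₙ n).M i j = 3 := by
    rw [matrix_apply, if_neg hij, if_pos (by tauto)]
  rw [h2] at h1
  have h3 : cs.simple i * cs.simple j * cs.simple i *
      (cs.simple j * cs.simple i * cs.simple j) = 1 := by
    rw [← h1]; simp only [pow_succ, pow_zero, one_mul, mul_assoc]
  have := eq_inv_of_mul_eq_one_left h3
  rw [this]
  simp only [mul_inv_rev, cs.inv_simple, mul_assoc]

/-- If `i` is not a right descent of `w`, the permutation of `w` ascends at `i`. -/
theorem toPerm_lt_of_not_isRightDescent (w : W) (i : Fin n) (hi : ¬ cs.IsRightDescent w i) :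
    toPerm cs w i.castSucc < toPerm cs w i.succ := by
  induction hw : cs.length w using Nat.strong_induction_on generalizing w i with
  | _ m ih =>
    subst hw
    rcases eq_or_ne w 1 with rfl | hw
    · simp [i.castSucc_lt_succ]
    obtain ⟨j, hj⟩ := cs.exists_rightDescent_of_ne_one hw
    have hij : i ≠ j := by rintro rfl; exact hi hj
    have hj' := cs.isRightDescent_iff.1 hj
    have hi' := cs.not_isRightDescent_iff.1 hi
    obtain ⟨v, rfl⟩ : ∃ v, w = v * cs.simple j := ⟨w * cs.simple j, by simp⟩
    have hvj : ¬ cs.IsRightDescent v j := by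
      rw [cs.isRightDescent_iff_not_isRightDescent_mul, not_not]; exact hj
    rw [cs.simple_mul_simple_cancel_right] at hj'
    rw [map_mul, toPerm_simple, Perm.mul_apply, Perm.mul_apply]
    by_cases hadj : i.val + 1 = j.val ∨ j.val + 1 = i.val
    · by_cases hvi : cs.IsRightDescent v i
      · have hvi' := cs.isRightDescent_iff.1 hvi
        obtain ⟨v', rfl⟩ : ∃ v', v = v' * cs.simple i := ⟨v * cs.simple i, by simp⟩
        rw [cs.simple_mul_simple_cancel_right] at hvi'
        have hv'j : ¬ cs.IsRightDescent v' j := by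
          intro hd
          have hd' := cs.isRightDescent_iff.1 hd
          have e : v' * cs.simple i * cs.simple j * cs.simple i =
              v' * cs.simple j * (cs.simple i * cs.simple j) := by
            rw [mul_assoc, mul_assoc, ← mul_assoc (cs.simple i), simple_braid cs hij hadj]
            simp only [mul_assoc]
          have h1 := cs.length_mul_le (v' * cs.simple j) (cs.simple i * cs.simple j)
          have h2 := cs.length_mul_le (cs.simple i) (cs.simple j)
          rw [e] at hi'
          simp only [cs.length_simple] at h2
          omega
        have key := ih _ (by omega) v' j hv'j rfl
        rw [map_mul, toPerm_simple, Perm.mul_apply, Perm.mul_apply]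
        rcases hadj with h | h
        · have e : i.succ = j.castSucc := Fin.ext (by simpa using h)
          have n1 : swap j.castSucc j.succ i.castSucc = i.castSucc := by
            apply swap_apply_of_ne_of_ne <;>
              simp only [Ne, Fin.ext_iff, Fin.val_castSucc, Fin.val_succ] <;> omega
          have n2 : swap i.castSucc j.castSucc j.succ = j.succ := by
            apply swap_apply_of_ne_of_ne <;>
              simp only [Ne, Fin.ext_iff, Fin.val_castSucc, Fin.val_succ] <;> omega
          rw [n1, e, swap_apply_left, swap_apply_left, n2]
          exact key
        · have e : j.succ = i.castSucc := Fin.ext (by simpa using h)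
          have n1 : swap j.castSucc i.castSucc i.succ = i.succ := by
            apply swap_apply_of_ne_of_ne <;>
              simp only [Ne, Fin.ext_iff, Fin.val_castSucc, Fin.val_succ] <;> omega
          have n2 : swap i.castSucc i.succ j.castSucc = j.castSucc := by
            apply swap_apply_of_ne_of_ne <;>
              simp only [Ne, Fin.ext_iff, Fin.val_castSucc, Fin.val_succ] <;> omega
          rw [e, swap_apply_right, n1, n2, swap_apply_right, ← e]
          exact key
      · have k1 := ih _ (by omega) v j hvj rfl
        have k2 := ih _ (by omega) v i hvi rfl
        rcases hadj with h | h
        · have e : i.succ = j.castSucc := Fin.ext (by simpa using h)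
          have n1 : swap j.castSucc j.succ i.castSucc = i.castSucc := by
            apply swap_apply_of_ne_of_ne <;>
              simp only [Ne, Fin.ext_iff, Fin.val_castSucc, Fin.val_succ] <;> omega
          rw [n1, e, swap_apply_left]
          rw [e] at k2
          exact k2.trans k1
        · have e : j.succ = i.castSucc := Fin.ext (by simpa using h)
          have n1 : swap j.castSucc i.castSucc i.succ = i.succ := by
            apply swap_apply_of_ne_of_ne <;>
              simp only [Ne, Fin.ext_iff, Fin.val_castSucc, Fin.val_succ] <;> omega
          rw [e, swap_apply_right, n1]
          rw [e] at k1
          exact k1.trans k2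
    · have hcomm := simple_commute cs hij hadj
      have hvi : ¬ cs.IsRightDescent v i := by
        intro hd
        have hd' := cs.isRightDescent_iff.1 hd
        have h1 := cs.length_mul_le (v * cs.simple i) (cs.simple j)
        rw [mul_assoc, ← hcomm, ← mul_assoc] at hi'
        rw [cs.length_simple] at h1
        omega
      have key := ih _ (by omega) v i hvi rfl
      have hij' : i.val ≠ j.val := fun h => hij (Fin.ext h)
      have n1 : swap j.castSucc j.succ i.castSucc = i.castSucc := by
        apply swap_apply_of_ne_of_ne <;>
          simp only [Ne, Fin.ext_iff, Fin.val_castSucc, Fin.val_succ] <;> omega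
      have n2 : swap j.castSucc j.succ i.succ = i.succ := by
        apply swap_apply_of_ne_of_ne <;>
          simp only [Ne, Fin.ext_iff, Fin.val_castSucc, Fin.val_succ] <;> omega
      rw [n1, n2]
      exact key

theorem toPerm_bijective : Function.Bijective (toPerm cs) := by
  constructor
  · rw [injective_iff_map_eq_one]
    intro w hw
    by_contra hne
    obtain ⟨i, hi⟩ := cs.exists_rightDescent_of_ne_one hne
    have h := toPerm_lt_of_not_isRightDescent cs (w * cs.simple i) i
      (cs.isRightDescent_iff_not_isRightDescent_mul.1 hi)
    rw [map_mul, hw, one_mul, toPerm_simple, swap_apply_left, swap_apply_right] at h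
    exact absurd h (not_lt.2 i.castSucc_lt_succ.le)
  · intro σ
    have hσ : σ ∈ Submonoid.closure (Set.range fun i : Fin n => swap i.castSucc i.succ) := by
      rw [Perm.mclosure_swap_castSucc_succ]; trivial
    induction hσ using Submonoid.closure_induction_right with
    | one => exact ⟨1, map_one _⟩
    | mul_right σ hσ s hs ih =>
      obtain ⟨w, rfl⟩ := ih
      obtain ⟨i, rfl⟩ := hs
      exact ⟨w * cs.simple i, by rw [map_mul, toPerm_simple]⟩

/-- The Coxeter group of type `Aₙ` is the symmetric group. -/
noncomputable def equivPerm : W ≃* Perm (Fin (n + 1)) :=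
  MulEquiv.ofBijective (toPerm cs) (toPerm_bijective cs)

theorem isInversionLength : IsInversionLength (fun σ => cs.length ((equivPerm cs).symm σ)) := by
  intro σ i h
  obtain ⟨w, rfl⟩ := (equivPerm cs).surjective σ
  have e : equivPerm cs w * swap i.castSucc i.succ = equivPerm cs (w * cs.simple i) := by
    rw [map_mul]
    exact congrArg _ (toPerm_simple cs i).symm
  simp only [e, MulEquiv.symm_apply_apply]
  rw [← cs.not_isRightDescent_iff, cs.isRightDescent_iff_not_isRightDescent_mul, not_not]
  by_contra hd
  have h2 := toPerm_lt_of_not_isRightDescent cs _ i hd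
  rw [map_mul, toPerm_simple, Perm.mul_apply, Perm.mul_apply, swap_apply_left,
    swap_apply_right] at h2
  exact absurd h (not_lt.2 h2.le)

theorem isSwap_equivPerm_iff (hn : 1 ≤ n) (t : W) :
    (equivPerm cs t).IsSwap ↔ cs.IsReflection t := by
  have hs : ∀ i, equivPerm cs (cs.simple i) = swap i.castSucc i.succ := toPerm_simple cs
  constructor
  · rintro ⟨a, b, hab, h⟩
    let i : Fin n := ⟨0, hn⟩
    obtain ⟨g, hg⟩ := isConj_iff.1 (Perm.isConj_swap i.castSucc_lt_succ.ne hab)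
    obtain ⟨w, rfl⟩ := (equivPerm cs).surjective g
    refine ⟨w, i, (equivPerm cs).injective ?_⟩
    rw [h, ← hg, map_mul, map_mul, map_inv, hs]
  · rintro ⟨w, i, rfl⟩
    rw [map_mul, map_mul, map_inv, hs]
    exact isSwap_conj ⟨_, _, i.castSucc_lt_succ.ne, rfl⟩ _

end TypeA

section BruhatGraph

variable {W : Type*} [Group W] {n : ℕ} (cs : CoxeterSystem (CoxeterMatrix.Aₙ n) W)

theorem exists_hexagon (hn : 1 ≤ n) {x y : W} (hxy : cs.IsReflection (x⁻¹ * y))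
    (hlt : cs.length x < cs.length y) (hne : cs.length y ≠ cs.length x + 1) :
    ∃ c₁ c₂ d₁ d₂, c₁ ≠ c₂ ∧ d₁ ≠ d₂ ∧ cs.length x < cs.length c₁ ∧ cs.length x < cs.length c₂ ∧
      cs.length c₁ < cs.length d₁ ∧ cs.length c₁ < cs.length d₂ ∧
      cs.length c₂ < cs.length d₁ ∧ cs.length c₂ < cs.length d₂ ∧
      cs.length d₁ < cs.length y ∧ cs.length d₂ < cs.length y ∧
      cs.IsReflection (x⁻¹ * c₁) ∧ cs.IsReflection (x⁻¹ * c₂) ∧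
      cs.IsReflection (c₁⁻¹ * d₁) ∧ cs.IsReflection (c₂⁻¹ * d₁) ∧
      cs.IsReflection (c₁⁻¹ * d₂) ∧ cs.IsReflection (c₂⁻¹ * d₂) ∧
      cs.IsReflection (d₁⁻¹ * y) ∧ cs.IsReflection (d₂⁻¹ * y) := by
  have h := (isInversionLength cs).exists_hexagon (x := equivPerm cs x) (y := equivPerm cs y)
  simp only [(equivPerm cs).surjective.exists, ← map_inv, ← map_mul, isSwap_equivPerm_iff cs hn,
    MulEquiv.symm_apply_apply, (equivPerm cs).injective.ne_iff] at h
  exact h hxy hlt hne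

theorem exists_diamond (hn : 1 ≤ n) {a b c : W} (hab : cs.IsReflection (a⁻¹ * b))
    (hbc : cs.IsReflection (b⁻¹ * c)) (h1 : cs.length a < cs.length b)
    (h2 : cs.length b < cs.length c) :
    ∃ b', b' ≠ b ∧ cs.IsReflection (a⁻¹ * b') ∧ cs.IsReflection (b'⁻¹ * c) ∧
      cs.length a < cs.length b' ∧ cs.length b' < cs.length c := by
  have h := (isInversionLength cs).exists_diamond (a := equivPerm cs a) (b := equivPerm cs b)
    (c := equivPerm cs c)
  simp only [(equivPerm cs).surjective.exists, ← map_inv, ← map_mul, isSwap_equivPerm_iff cs hn,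
    MulEquiv.symm_apply_apply, (equivPerm cs).injective.ne_iff] at h
  exact h hab hbc h1 h2

theorem isReflection_of_three_common (hn : 1 ≤ n) {x c₁ c₂ d₁ d₂ y : W} (hc : c₁ ≠ c₂)
    (h1 : x ≠ d₁) (h2 : x ≠ d₂) (h12 : d₁ ≠ d₂)
    (hxc1 : cs.IsReflection (x⁻¹ * c₁)) (hxc2 : cs.IsReflection (x⁻¹ * c₂))
    (h11 : cs.IsReflection (c₁⁻¹ * d₁)) (h21 : cs.IsReflection (c₂⁻¹ * d₁))
    (h12' : cs.IsReflection (c₁⁻¹ * d₂)) (h22 : cs.IsReflection (c₂⁻¹ * d₂))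
    (hy1 : cs.IsReflection (d₁⁻¹ * y)) (hy2 : cs.IsReflection (d₂⁻¹ * y)) :
    cs.IsReflection (x⁻¹ * y) := by
  have hinj := (equivPerm cs).injective
  simp only [← isSwap_equivPerm_iff cs hn, map_mul, map_inv] at *
  exact isSwap_of_three_common (hinj.ne hc) (hinj.ne h1) (hinj.ne h2) (hinj.ne h12)
    hxc1 hxc2 h11 h21 h12' h22 hy1 hy2

theorem exists_complement :
    ∃ (g : W) (c : ℕ), ∀ a, cs.length a + cs.length (a * g) = c := by
  obtain ⟨g, c, h⟩ := (isInversionLength cs).exists_complement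
  refine ⟨(equivPerm cs).symm g, c, fun a => ?_⟩
  simpa using h (equivPerm cs a)

theorem isReflection_symm {B W : Type*} [Group W] {M : CoxeterMatrix B} (cs : CoxeterSystem M W)
    {a b : W} (h : cs.IsReflection (a⁻¹ * b)) : cs.IsReflection (b⁻¹ * a) := by
  have := h.isReflection_inv
  rwa [mul_inv_rev, inv_inv] at this

theorem length_ne_of_isReflection {B W : Type*} [Group W] {M : CoxeterMatrix B}
    (cs : CoxeterSystem M W) {a b : W} (h : cs.IsReflection (a⁻¹ * b)) :
    cs.length a ≠ cs.length b := by
  have := h.length_mul_left_ne a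
  rw [mul_inv_cancel_left] at this
  exact this.symm

theorem bruhatStep_iff {B W : Type*} [Group W] {M : CoxeterMatrix B} (cs : CoxeterSystem M W)
    {a b : W} : BruhatStep cs a b ↔ cs.IsReflection (a⁻¹ * b) ∧ cs.length a < cs.length b := by
  constructor
  · rintro ⟨t, ht, rfl, h⟩
    refine ⟨?_, h⟩
    have := ht.conj a⁻¹
    rwa [inv_inv, mul_assoc] at this
  · rintro ⟨h1, h2⟩
    refine ⟨b * a⁻¹, ?_, by group, h2⟩
    have := h1.conj a
    rwa [mul_inv_cancel_left] at this

theorem bruhatLE_of_isReflection {B W : Type*} [Group W] {M : CoxeterMatrix B}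
    (cs : CoxeterSystem M W) {a b : W} (h : cs.IsReflection (a⁻¹ * b))
    (hl : cs.length a < cs.length b) : BruhatLE cs a b :=
  .single ((bruhatStep_iff cs).2 ⟨h, hl⟩)

theorem isReflection_of_bruhatLE {B W : Type*} [Group W] {M : CoxeterMatrix B}
    (cs : CoxeterSystem M W) {a b : W} (h : BruhatLE cs a b)
    (hl : cs.length b = cs.length a + 1) : cs.IsReflection (a⁻¹ * b) := by
  rcases Relation.ReflTransGen.cases_head h with h' | ⟨c, hc, h'⟩
  · subst h'; omega
  · rw [bruhatStep_iff] at hc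
    by_cases hcb : c = b
    · exact hcb ▸ hc.1
    · have := BruhatLE.length_lt h' hcb
      omega

/-- Right multiplication by an element complementing lengths reverses the Bruhat order. -/
theorem BruhatLE.mul_right_of_complement {B W : Type*} [Group W] {M : CoxeterMatrix B}
    {cs : CoxeterSystem M W} {g : W} {c : ℕ} (hg : ∀ a, cs.length a + cs.length (a * g) = c)
    {a b : W} (h : BruhatLE cs a b) : BruhatLE cs (b * g) (a * g) := by
  induction h with
  | refl => exact .refl
  | tail _ h ih =>
    rename_i x y _
    refine .head ?_ ih
    rw [bruhatStep_iff] at h ⊢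
    have h1 := hg x
    have h2 := hg y
    refine ⟨?_, by omega⟩
    have := (isReflection_symm cs h.1).conj g⁻¹
    convert this using 1
    group

theorem bruhatLE_mul_right_iff {B W : Type*} [Group W] {M : CoxeterMatrix B}
    {cs : CoxeterSystem M W} {g : W} {c : ℕ} (hg : ∀ a, cs.length a + cs.length (a * g) = c)
    {a b : W} : BruhatLE cs (b * g) (a * g) ↔ BruhatLE cs a b := by
  refine ⟨fun h => ?_, fun h => h.mul_right_of_complement hg⟩
  have hg' : ∀ a, cs.length a + cs.length (a * g⁻¹) = c := fun a => by
    have := hg (a * g⁻¹)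
    rw [inv_mul_cancel_right] at this
    omega
  simpa using h.mul_right_of_complement hg'

section Matching

variable {cs} {u w : W}

theorem length_lt_of_lt {a b : BruhatInterval cs u w} (h : a < b) :
    cs.length a.1 < cs.length b.1 :=
  BruhatLE.length_lt (show BruhatLE cs a.1 b.1 from h.le) (fun he => h.ne (Subtype.ext he))

theorem covBy_of_isReflection {a b : BruhatInterval cs u w} (h : cs.IsReflection (a.1⁻¹ * b.1))
    (hl : cs.length b.1 = cs.length a.1 + 1) : a ⋖ b := by
  refine ⟨lt_of_le_of_ne (bruhatLE_of_isReflection cs h (by omega)) ?_, fun c h1 h2 => ?_⟩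
  · rintro rfl; omega
  · have := length_lt_of_lt h1
    have := length_lt_of_lt h2
    omega

theorem isReflection_of_covBy (hn : 1 ≤ n) {a b : BruhatInterval cs u w} (h : a ⋖ b) :
    cs.IsReflection (a.1⁻¹ * b.1) ∧ cs.length b.1 = cs.length a.1 + 1 := by
  have hab : BruhatLE cs a.1 b.1 := h.1.le
  have no : ∀ c, BruhatLE cs a.1 c → BruhatLE cs c b.1 → a.1 ≠ c → c ≠ b.1 → False := by
    intro c h1 h2 h3 h4
    exact h.2 (c := ⟨c, a.2.1.trans h1, h2.trans b.2.2⟩)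
      (lt_of_le_of_ne h1 fun he => h3 (congrArg Subtype.val he))
      (lt_of_le_of_ne h2 fun he => h4 (congrArg Subtype.val he))
  have hr : cs.IsReflection (a.1⁻¹ * b.1) := by
    rcases Relation.ReflTransGen.cases_head hab with h' | ⟨c, hc, h'⟩
    · exact absurd (Subtype.ext h') h.1.ne
    · by_cases hcb : c = b.1
      · exact hcb ▸ ((bruhatStep_iff cs).1 hc).1
      · obtain ⟨t, -, -, hlt⟩ := id hc
        exact (no c (.single hc) h' (fun he => by rw [he] at hlt; omega) hcb).elim
  refine ⟨hr, ?_⟩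
  by_contra hne
  obtain ⟨c₁, -, d₁, -, -, -, l1, -, l2, -, -, -, l3, -, r1, -, r2, -, -, -, r3, -⟩ :=
    exists_hexagon cs hn hr (length_lt_of_lt h.1) hne
  exact no c₁ (bruhatLE_of_isReflection cs r1 l1)
    ((bruhatLE_of_isReflection cs r2 l2).trans (bruhatLE_of_isReflection cs r3 l3))
    (fun he => by rw [he] at l1; omega) (fun he => by rw [he] at l2; omega)

/-- A special matching of a Bruhat interval is an automorphism of its (undirected) Bruhat
graph. -/
theorem IsSpecialMatching.isReflection (hn : 1 ≤ n)
    {f : BruhatInterval cs u w → BruhatInterval cs u w} (hf : IsSpecialMatching f)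
    {a b : BruhatInterval cs u w} (h : cs.IsReflection (a.1⁻¹ * b.1)) :
    cs.IsReflection ((f a).1⁻¹ * (f b).1) := by
  wlog hlt : cs.length a.1 < cs.length b.1 generalizing a b
  · have hl := length_ne_of_isReflection cs h
    exact isReflection_symm cs (this (isReflection_symm cs h) (by omega))
  obtain ⟨⟨hinv, hmatch⟩, hspec⟩ := hf
  have hedge : ∀ x, cs.IsReflection ((f x).1⁻¹ * x.1) ∧
      (cs.length (f x).1 = cs.length x.1 + 1 ∨ cs.length x.1 = cs.length (f x).1 + 1) := by
    intro x
    rcases hmatch x with hx | hx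
    · have := isReflection_of_covBy hn hx
      exact ⟨this.1, .inr this.2⟩
    · have := isReflection_of_covBy hn hx
      exact ⟨isReflection_symm cs this.1, .inl this.2⟩
  have vne : ∀ {x y : BruhatInterval cs u w}, x ≠ y → x.1 ≠ y.1 := fun hxy he =>
    hxy (Subtype.ext he)
  induction hd : cs.length b.1 - cs.length a.1 using Nat.strong_induction_on generalizing a b with
  | _ m ih =>
  subst hd
  by_cases hcov : cs.length b.1 = cs.length a.1 + 1
  · rcases hspec a b (covBy_of_isReflection h hcov) with hab | hab
    · rw [← hab, hinv a, hab]
      exact isReflection_symm cs h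
    · have hll := length_lt_of_lt hab
      by_cases hone : cs.length (f b).1 = cs.length (f a).1 + 1
      · exact isReflection_of_bruhatLE cs hab.le hone
      have ha := hedge a
      have hb := hedge b
      obtain ⟨z, hza, hz1, hz2, hl1, hl2⟩ := exists_diamond cs hn ha.1 h (by omega) (by omega)
      let z' : BruhatInterval cs u w := ⟨z,
        (f a).2.1.trans (bruhatLE_of_isReflection cs hz1 hl1),
        (bruhatLE_of_isReflection cs hz2 hl2).trans b.2.2⟩
      have hzr := hedge z'
      have hzl : cs.length z'.1 = cs.length z := rfl
      have k1 := hspec (f a) z' (covBy_of_isReflection hz1 (by omega))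
      rw [hinv a] at k1
      have k1' := length_lt_of_lt (k1.resolve_left fun he => hza (congrArg Subtype.val he).symm)
      have k2 := hspec z' b (covBy_of_isReflection hz2 (by omega))
      have hfz : f z' ≠ b := by
        intro he
        have hbz : f b = z' := by rw [← he, hinv]
        have hbl : cs.length (f b).1 = cs.length z := by rw [hbz]
        omega
      have k2' := k2.resolve_left hfz
      have k2l := length_lt_of_lt k2'
      have r1 : cs.IsReflection (a.1⁻¹ * (f z').1) :=
        isReflection_of_bruhatLE cs
          (k1.resolve_left fun he => hza (congrArg Subtype.val he).symm).le (by omega)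
      have r2 : cs.IsReflection ((f z').1⁻¹ * (f b).1) :=
        isReflection_of_bruhatLE cs k2'.le (by omega)
      refine isReflection_of_three_common cs hn (c₁ := a.1) (c₂ := z) (d₁ := b.1)
        (d₂ := (f z').1) (Ne.symm hza) ?_ ?_ (vne hfz.symm) ha.1 hz1 h hz2 r1
        (isReflection_symm cs hzr.1) (isReflection_symm cs hb.1) r2
      · intro he
        have hl := congrArg cs.length he
        omega
      · intro he
        have hl := congrArg cs.length he
        omega
  · obtain ⟨c₁, c₂, d₁, d₂, hc, hd, l1, l2, l3, l4, l5, l6, l7, l8, r1, r2, r3, r4, r5, r6, r7,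
      r8⟩ := exists_hexagon cs hn h hlt hcov
    have le := @bruhatLE_of_isReflection _ _ _ _ cs
    let C₁ : BruhatInterval cs u w := ⟨c₁, a.2.1.trans (le r1 l1),
      ((le r3 l3).trans (le r7 l7)).trans b.2.2⟩
    let C₂ : BruhatInterval cs u w := ⟨c₂, a.2.1.trans (le r2 l2),
      ((le r4 l5).trans (le r7 l7)).trans b.2.2⟩
    let D₁ : BruhatInterval cs u w := ⟨d₁, C₁.2.1.trans (le r3 l3), (le r7 l7).trans b.2.2⟩
    let D₂ : BruhatInterval cs u w := ⟨d₂, C₁.2.1.trans (le r5 l4), (le r8 l8).trans b.2.2⟩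
    have fne : ∀ {x y : BruhatInterval cs u w}, x.1 ≠ y.1 → (f x).1 ≠ (f y).1 := fun hxy =>
      vne fun he => hxy (congrArg Subtype.val (hinv.injective he))
    refine isReflection_of_three_common cs hn (c₁ := (f C₁).1) (c₂ := (f C₂).1)
      (d₁ := (f D₁).1) (d₂ := (f D₂).1) (fne hc) (fne ?_) (fne ?_) (fne hd)
      (ih _ ?_ r1 l1 rfl) (ih _ ?_ r2 l2 rfl) (ih _ ?_ r3 l3 rfl) (ih _ ?_ r4 l5 rfl)
      (ih _ ?_ r5 l4 rfl) (ih _ ?_ r6 l6 rfl) (ih _ ?_ r7 l7 rfl) (ih _ ?_ r8 l8 rfl)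
    · intro he
      have : cs.length a.1 = cs.length d₁ := congrArg _ he
      omega
    · intro he
      have : cs.length a.1 = cs.length d₂ := congrArg _ he
      omega
    all_goals
      simp only [C₁, C₂, D₁, D₂]
      omega

end Matching

end BruhatGraph

theorem IsSpecialMatching.conj {α β : Type*} [PartialOrder α] [PartialOrder β] (φ : α ≃o β)
    {f : α → α} (hf : IsSpecialMatching f) :
    IsSpecialMatching (fun x => φ (f (φ.symm x))) := by
  have hcov : ∀ {x y : β}, φ.symm x ⋖ φ.symm y ↔ x ⋖ y := apply_covBy_apply_iff φ.symm
  refine ⟨⟨fun x => ?_, fun x => ?_⟩, fun x y hxy => ?_⟩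
  · simp [hf.1.1 (φ.symm x)]
  · rw [← hcov, ← hcov, φ.symm_apply_apply]
    exact hf.1.2 _
  · rw [← φ.eq_symm_apply, φ.lt_iff_lt]
    exact hf.2 _ _ (hcov.2 hxy)

/-- In a zircon, every nontrivial lower interval has a special matching. -/
theorem IsZircon.exists_isSpecialMatching {B W : Type*} [Group W] {M : CoxeterMatrix B}
    {cs : CoxeterSystem M W} {u w : W} (hz : IsZircon (BruhatInterval cs u w)) {x : W}
    (hux : BruhatLE cs u x) (hxw : BruhatLE cs x w) (hne : u ≠ x) :
    ∃ f : BruhatInterval cs u x → BruhatInterval cs u x, IsSpecialMatching f := by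
  let x' : BruhatInterval cs u w := ⟨x, hux, hxw⟩
  let u' : BruhatInterval cs u w := ⟨u, .refl, hux.trans hxw⟩
  obtain ⟨-, f, hf⟩ := hz x' ⟨u', lt_of_le_of_ne hux fun he => hne (congrArg Subtype.val he)⟩
  let φ : {v : BruhatInterval cs u w // v ≤ x'} ≃o BruhatInterval cs u x :=
    { toFun := fun v => ⟨v.1.1, v.1.2.1, v.2⟩
      invFun := fun v => ⟨⟨v.1, v.2.1, v.2.2.trans hxw⟩, v.2.2⟩
      left_inv := fun _ => rfl
      right_inv := fun _ => rfl
      map_rel_iff' := Iff.rfl }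
  exact ⟨_, hf.conj φ⟩

section Degree

variable {W : Type*} [Group W] {n : ℕ} {cs : CoxeterSystem (CoxeterMatrix.Aₙ n) W}

/-- If every nontrivial lower interval of `[u,w]` has a special matching, then the degree of `w`
in the Bruhat graph of `[u,w]` is `ℓ(w) - ℓ(u)`. -/
theorem bruhatDeg_top_eq (hn : 1 ≤ n) {u w : W} (huw : BruhatLE cs u w)
    (H : ∀ x, BruhatLE cs u x → BruhatLE cs x w → u ≠ x →
      ∃ f : BruhatInterval cs u x → BruhatInterval cs u x, IsSpecialMatching f) :
    bruhatDeg cs u w w = cs.length w - cs.length u := by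
  induction hm : cs.length w using Nat.strong_induction_on generalizing w with
  | _ m ih =>
  subst hm
  have : Finite W := Finite.of_equiv _ (equivPerm cs).symm.toEquiv
  rcases eq_or_ne u w with rfl | hne
  · rw [Nat.sub_self, bruhatDeg, Nat.card_eq_zero]
    refine .inl ⟨fun ⟨y, ⟨h1, h2⟩, h3⟩ => ?_⟩
    exact length_ne_of_isReflection cs h3 (le_antisymm h1.length_le h2.length_le)
  obtain ⟨f, hf⟩ := H w huw .refl hne
  let top : BruhatInterval cs u w := ⟨w, huw, .refl⟩
  have htop : ∀ x : BruhatInterval cs u w, x ≤ top := fun x => x.2.2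
  have hcov := isReflection_of_covBy hn
    ((hf.1.2 top).resolve_right fun h => (htop (f top)).not_gt h.1)
  obtain ⟨hxr, hxl⟩ := hcov
  set x := (f top).1 with hx
  change cs.IsReflection (x⁻¹ * w) at hxr
  change cs.length w = cs.length x + 1 at hxl
  have hux : BruhatLE cs u x := (f top).2.1
  have hxw : BruhatLE cs x w := (f top).2.2
  have hinv : ∀ y : BruhatInterval cs u w, (f (f y)).1 = y.1 :=
    fun y => congrArg Subtype.val (hf.1.1 y)
  have hdeg : bruhatDeg cs u w w = bruhatDeg cs u w x := by
    refine Nat.card_congr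
      { toFun := fun y => ⟨(f ⟨y.1, y.2.1⟩).1, (f ⟨y.1, y.2.1⟩).2,
          hf.isReflection hn (a := top) y.2.2⟩
        invFun := fun y => ⟨(f ⟨y.1, y.2.1⟩).1, (f ⟨y.1, y.2.1⟩).2, ?_⟩
        left_inv := fun y => Subtype.ext (hinv ⟨y.1, y.2.1⟩)
        right_inv := fun y => Subtype.ext (hinv ⟨y.1, y.2.1⟩) }
    have := hf.isReflection hn (a := f top) (b := ⟨y.1, y.2.1⟩) y.2.2
    rwa [hf.1.1 top] at this
  have hsucc : bruhatDeg cs u w x = bruhatDeg cs u x x + 1 := by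
    have hset : {y | (BruhatLE cs u y ∧ BruhatLE cs y w) ∧ cs.IsReflection (x⁻¹ * y)} =
        insert w {y | (BruhatLE cs u y ∧ BruhatLE cs y x) ∧ cs.IsReflection (x⁻¹ * y)} := by
      ext y
      simp only [Set.mem_setOf_eq, Set.mem_insert_iff]
      constructor
      · rintro ⟨⟨h1, h2⟩, h3⟩
        rcases lt_or_gt_of_ne (length_ne_of_isReflection cs h3) with h | h
        · left
          by_contra hyw
          have := h2.length_lt hyw
          omega
        · exact .inr ⟨⟨h1, bruhatLE_of_isReflection cs (isReflection_symm cs h3) h⟩, h3⟩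
      · rintro (rfl | ⟨⟨h1, h2⟩, h3⟩)
        · exact ⟨⟨huw, .refl⟩, hxr⟩
        · exact ⟨⟨h1, h2.trans hxw⟩, h3⟩
    have hnot : w ∉ {y | (BruhatLE cs u y ∧ BruhatLE cs y x) ∧ cs.IsReflection (x⁻¹ * y)} := by
      rintro ⟨⟨-, h⟩, -⟩
      have := h.length_le
      omega
    have := Set.ncard_insert_of_notMem hnot (Set.toFinite _)
    rw [← hset] at this
    exact this
  have hrec := ih (cs.length x) (by omega) hux (fun y h1 h2 => H y h1 (h2.trans hxw)) rfl
  have := hux.length_le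
  rw [hdeg, hsucc, hrec]
  omega

theorem bruhatDeg_mul_right_of_complement {B W : Type*} [Group W] {M : CoxeterMatrix B}
    {cs : CoxeterSystem M W} {g : W} {c : ℕ} (hg : ∀ a, cs.length a + cs.length (a * g) = c)
    (u w v : W) : bruhatDeg cs (w * g) (u * g) (v * g) = bruhatDeg cs u w v := by
  refine (Nat.card_congr ((Equiv.mulRight g).subtypeEquiv fun y => ?_)).symm
  rw [Equiv.coe_mulRight, bruhatLE_mul_right_iff hg, bruhatLE_mul_right_iff hg,
    and_comm (a := BruhatLE cs u y)]
  have e : (v * g)⁻¹ * (y * g) = g⁻¹ * (v⁻¹ * y) * g⁻¹⁻¹ := by group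
  rw [e, cs.isReflection_conj_iff]

end Degree

end SymmetricGroup

/-- Suppose that for every smooth Bruhat interval `[u,w]` in the symmetric
group `S_(n+1)` (type `Aₙ`) there is a simple reflection `s ∉ D_L(u)` with `su ≰ w` or
`sw < w`. Then for every Bruhat interval `[u,w]` in `S_(n+1)` which is a zircon, there is
`s ∈ D_L(w)` with `sw ≱ u` or `su > u`. -/
theorem conjC4_implies_delanoy
    {W : Type*} [Group W] {n : ℕ} (hn : 1 ≤ n)
    (cs : CoxeterSystem (CoxeterMatrix.Aₙ n) W)
    (H : ∀ u w : W, BruhatLE cs u w → u ≠ w →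
      bruhatDeg cs u w u = cs.length w - cs.length u →
      ∃ i : Fin n, ¬ cs.IsLeftDescent u i ∧
        (¬ BruhatLE cs (cs.simple i * u) w ∨
          (BruhatLE cs (cs.simple i * w) w ∧ cs.simple i * w ≠ w))) :
    ∀ u w : W, BruhatLE cs u w → u ≠ w →
      IsZircon (BruhatInterval cs u w) →
      ∃ i : Fin n, cs.IsLeftDescent w i ∧
        (¬ BruhatLE cs u (cs.simple i * w) ∨
          (BruhatLE cs u (cs.simple i * u) ∧ cs.simple i * u ≠ u)) := by
  intro u w huw hne hz
  obtain ⟨g, c, hg⟩ := exists_complement cs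
  have hdeg := bruhatDeg_top_eq hn huw fun x h1 h2 h3 => hz.exists_isSpecialMatching h1 h2 h3
  have hu := hg u
  have hw := hg w
  obtain ⟨i, hi, h⟩ := H (w * g) (u * g) (huw.mul_right_of_complement hg)
    (fun he => hne (mul_right_cancel he).symm)
    (by rw [bruhatDeg_mul_right_of_complement hg, hdeg]; omega)
  have hsw := hg (cs.simple i * w)
  have hsu := hg (cs.simple i * u)
  rw [CoxeterSystem.IsLeftDescent, ← mul_assoc] at hi
  simp only [← mul_assoc] at h
  refine ⟨i, ?_, ?_⟩
  · have := cs.length_simple_mul_ne w i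
    rw [CoxeterSystem.IsLeftDescent]
    omega
  · refine h.imp ?_ ?_
    · rw [bruhatLE_mul_right_iff hg]
      exact id
    · rw [bruhatLE_mul_right_iff hg]
      exact fun h => ⟨h.1, fun he => h.2 (by rw [he])⟩

end Paper
end
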